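/- Let f ∈ C¹(ℝ^n, ℝ^m) with ‖f‖_{C¹} = 1. For every μ ∈ 𝒫_f there exists a matrix-valued measure M ∈ 𝓜(ℝ^n, ℝ^{m×n}) with −div M = μ such that ‖M‖₁-almost everywhere: (i) Df Df^* = Id on the image of dM/d‖M‖₁, and (ii) Df^* (dM/d‖M‖₁) is symmetric and positive semidefinite; moreover ‖M‖_𝓜 = ∫⟨f, dμ⟩. Conversely, if M ∈ 𝓜(ℝ^n, ℝ^{m×n}) is such that −div M is a finite vector-valued measure and conditions (i) and (ii) hold ‖M‖₁-almost everywhere, then −div M ∈ 𝒫_f. -/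

import Mathlib

open Matrix MeasureTheory Filter
open scoped RealInnerProductSpace Topology

noncomputable section

/-- Real power of a square real matrix via spectral decomposition (junk value `0`
for non-Hermitian matrices). -/
def matPow {n : ℕ} (A : Matrix (Fin n) (Fin n) ℝ) (r : ℝ) : Matrix (Fin n) (Fin n) ℝ :=
  if hA : A.IsHermitian then
    (hA.eigenvectorUnitary : Matrix (Fin n) (Fin n) ℝ) *
      Matrix.diagonal (fun i => (hA.eigenvalues i) ^ r) *
      (star hA.eigenvectorUnitary : Matrix.unitaryGroup (Fin n) ℝ)
  else 0

/-- Absolute value `|A| = (A^* A)^{1/2}` of a real rectangular matrix. -/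
def matAbs {m n : ℕ} (A : Matrix (Fin m) (Fin n) ℝ) : Matrix (Fin n) (Fin n) ℝ :=
  matPow (Aᴴ * A) (1/2)

/-- Euclidean space ℝⁿ. -/
abbrev Euc (n : ℕ) := EuclideanSpace ℝ (Fin n)

/-- Frobenius (trace) pairing ⟨A, B⟩ = tr(AB^*) of two m×n matrices. -/
def frob {m n : ℕ} (A B : Matrix (Fin m) (Fin n) ℝ) : ℝ := Matrix.trace (A * Bᴴ)

/-- The matrix of the Fréchet derivative of f : ℝⁿ → ℝᵐ at x. -/
def fderivMat {n m : ℕ} (f : Euc n → Euc m) (x : Euc n) : Matrix (Fin m) (Fin n) ℝ :=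
  Matrix.of fun i j => fderiv ℝ f x (EuclideanSpace.single j 1) i

/-- f ∈ C¹(ℝⁿ, ℝᵐ): continuously differentiable with bounded derivative. -/
def C1b {n m : ℕ} (f : Euc n → Euc m) : Prop :=
  ContDiff ℝ 1 f ∧ ∃ C : ℝ, ∀ x, ‖fderiv ℝ f x‖ ≤ C

/-- f ∈ C¹₀(ℝⁿ, ℝᵐ): continuously differentiable with derivative vanishing at
infinity. -/
def C1z {n m : ℕ} (f : Euc n → Euc m) : Prop :=
  ContDiff ℝ 1 f ∧ Tendsto (fun x => ‖fderiv ℝ f x‖) (cocompact (Euc n)) (nhds 0)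

/-- The C¹ seminorm ‖f‖_{C¹} = sup_x ‖Df(x)‖ (operator norm). -/
def C1Norm {n m : ℕ} (f : Euc n → Euc m) : ℝ := ⨆ x, ‖fderiv ℝ f x‖

/-- An ℝᵐ-valued Borel measure μ on ℝⁿ of finite total variation, encoded by its
total variation measure `var = ‖μ‖` together with its polar (Radon–Nikodym)
density `density = dμ/d‖μ‖`, a vector field of norm one ‖μ‖-a.e.; thus
μ(E) = ∫_E density d‖μ‖. -/
structure VecMeas (n m : ℕ) where
  var : Measure (Euc n)
  density : Euc n → Euc m
  finite : IsFiniteMeasure var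
  measurable_density : Measurable density
  norm_density : ∀ᵐ x ∂var, ‖density x‖ = 1

/-- The pairing ∫ ⟨f, dμ⟩. -/
def VecMeas.pair {n m : ℕ} (μ : VecMeas n m) (f : Euc n → Euc m) : ℝ :=
  ∫ x, ⟪f x, μ.density x⟫ ∂μ.var

/-- μ(ℝⁿ) = 0. -/
def VecMeas.totalZero {n m : ℕ} (μ : VecMeas n m) : Prop :=
  ∫ x, μ.density x ∂μ.var = 0

/-- Finite first moments: ∫ ‖x‖ d‖μ‖(x) < ∞. -/
def VecMeas.finiteFirstMoment {n m : ℕ} (μ : VecMeas n m) : Prop :=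
  Integrable (fun x => ‖x‖) μ.var

/-- An ℝ^{m×n}-valued Borel measure M on ℝⁿ of finite total variation with
respect to the Schatten 1-norm, encoded by its total variation measure
`var = ‖M‖₁` together with its Radon–Nikodym density `density = dM/d‖M‖₁`,
a matrix field of Schatten 1-norm one ‖M‖₁-a.e. -/
structure MatMeas (n m : ℕ) where
  var : Measure (Euc n)
  density : Euc n → Matrix (Fin m) (Fin n) ℝ
  finite : IsFiniteMeasure var
  measurable_density : ∀ i j, Measurable fun x => density x i j
  norm_density : ∀ᵐ x ∂var, Matrix.trace (matAbs (density x)) = 1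

/-- The total variation norm ‖M‖_𝓜 = ‖M‖₁(ℝⁿ). -/
def MatMeas.tvNorm {n m : ℕ} (M : MatMeas n m) : ℝ := (M.var Set.univ).toReal

/-- The pairing ∫ ⟨G, dM⟩ of a matrix field G against M. -/
def MatMeas.pair {n m : ℕ} (M : MatMeas n m) (G : Euc n → Matrix (Fin m) (Fin n) ℝ) : ℝ :=
  ∫ x, frob (G x) (M.density x) ∂M.var

/-- −div M = μ: for all f ∈ C¹₀(ℝⁿ, ℝᵐ), ∫⟨f, dμ⟩ = ∫⟨Df, dM⟩. -/
def IsNegDiv {n m : ℕ} (M : MatMeas n m) (μ : VecMeas n m) : Prop :=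
  ∀ f : Euc n → Euc m, C1z f → μ.pair f = M.pair (fderivMat f)

/-- J(μ) = sup { ∫⟨u, dμ⟩ : u ∈ C¹(ℝⁿ,ℝᵐ), ‖u‖_{C¹} ≤ 1 }. -/
def Jsup {n m : ℕ} (μ : VecMeas n m) : ℝ :=
  sSup {r | ∃ f : Euc n → Euc m, C1b f ∧ C1Norm f ≤ 1 ∧ r = μ.pair f}

/-- I(μ) = inf { ‖M‖_𝓜 : −div M = μ }. -/
def Iinf {n m : ℕ} (μ : VecMeas n m) : ℝ :=
  sInf {r | ∃ M : MatMeas n m, IsNegDiv M μ ∧ r = M.tvNorm}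

section LinAlg

/-- The matrix of a continuous linear map. -/
def matOf {n m : ℕ} (T : Euc n →L[ℝ] Euc m) : Matrix (Fin m) (Fin n) ℝ :=
  Matrix.of fun i j => T (EuclideanSpace.single j 1) i

/-- The operator of a matrix. -/
def opOf {n m : ℕ} (A : Matrix (Fin m) (Fin n) ℝ) : Euc n →L[ℝ] Euc m :=
  LinearMap.toContinuousLinearMap (Matrix.toEuclideanLin A)

lemma matOf_opOf {n m : ℕ} (A : Matrix (Fin m) (Fin n) ℝ) : matOf (opOf A) = A := by
  ext i j
  simp [matOf, opOf, Matrix.toLpLin_apply, PiLp.toLp_apply]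

lemma opOf_matOf {n m : ℕ} (T : Euc n →L[ℝ] Euc m) : opOf (matOf T) = T := by
  ext x i
  have hx : x = ∑ j, x j • EuclideanSpace.single j (1 : ℝ) := by
    ext k
    simp [Finset.sum_apply, Pi.single_apply]
  conv_rhs => rw [hx]
  simp [matOf, opOf, Matrix.toLpLin_apply, Matrix.mulVec, dotProduct, mul_comm]

lemma opOf_mul {n m k : ℕ} (A : Matrix (Fin m) (Fin n) ℝ) (B : Matrix (Fin n) (Fin k) ℝ) :
    opOf (A * B) = (opOf A).comp (opOf B) := by
  ext x i
  simp [opOf, Matrix.toLpLin_apply]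

lemma opOf_conjTranspose {n m : ℕ} (A : Matrix (Fin m) (Fin n) ℝ) :
    opOf Aᴴ = (opOf A).adjoint := by
  unfold opOf
  rw [Matrix.toEuclideanLin_conjTranspose_eq_adjoint, LinearMap.adjoint_toContinuousLinearMap]

lemma opOf_inj {n m : ℕ} {A B : Matrix (Fin m) (Fin n) ℝ} (h : opOf A = opOf B) : A = B := by
  rw [← matOf_opOf A, h, matOf_opOf]

lemma trace_matOf {n : ℕ} (A : Matrix (Fin n) (Fin n) ℝ) (w : OrthonormalBasis (Fin n) ℝ (Euc n)) :
    A.trace = ∑ i, ⟪w i, opOf A (w i)⟫ := by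
  have h1 := LinearMap.trace_eq_sum_inner (Matrix.toEuclideanLin A) w
  have h2 := LinearMap.trace_eq_sum_inner (Matrix.toEuclideanLin A)
    (EuclideanSpace.basisFun (Fin n) ℝ)
  have h3 : A.trace = ∑ i, ⟪EuclideanSpace.basisFun (Fin n) ℝ i,
      Matrix.toEuclideanLin A (EuclideanSpace.basisFun (Fin n) ℝ i)⟫ := by
    simp [Matrix.trace, Matrix.toLpLin_apply, EuclideanSpace.inner_single_left]
  rw [h3, ← h2, h1]
  rfl

lemma frob_eq {n m : ℕ} (B D : Matrix (Fin m) (Fin n) ℝ)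
    (w : OrthonormalBasis (Fin n) ℝ (Euc n)) :
    frob B D = ∑ i, ⟪opOf B (w i), opOf D (w i)⟫ := by
  unfold frob
  rw [Matrix.trace_mul_comm, trace_matOf _ w, opOf_mul, opOf_conjTranspose]
  refine Finset.sum_congr rfl fun i _ => ?_
  rw [ContinuousLinearMap.comp_apply, ContinuousLinearMap.adjoint_inner_right, real_inner_comm]

lemma exists_svd {n m : ℕ} (D : Matrix (Fin m) (Fin n) ℝ) :
    ∃ w : OrthonormalBasis (Fin n) ℝ (Euc n),
      Matrix.trace (matAbs D) = ∑ i, ‖opOf D (w i)‖ ∧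
      ∀ i, (opOf D).adjoint (opOf D (w i)) = ‖opOf D (w i)‖ ^ 2 • w i := by
  have hH : (Dᴴ * D).IsHermitian := Matrix.isHermitian_conjTranspose_mul_self D
  have key : ∀ i, (opOf D).adjoint (opOf D (hH.eigenvectorBasis i))
      = hH.eigenvalues i • hH.eigenvectorBasis i := by
    intro i
    have h := hH.mulVec_eigenvectorBasis i
    rw [← opOf_conjTranspose, ← ContinuousLinearMap.comp_apply, ← opOf_mul]
    ext k
    have := congrFun h k
    simpa [opOf, Matrix.toLpLin_apply] using this
  have hn : ∀ i, ‖opOf D (hH.eigenvectorBasis i)‖ ^ 2 = hH.eigenvalues i := by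
    intro i
    rw [← real_inner_self_eq_norm_sq, ← ContinuousLinearMap.adjoint_inner_right, key,
      inner_smul_right, real_inner_self_eq_norm_sq, hH.eigenvectorBasis.norm_eq_one]
    simp
  refine ⟨hH.eigenvectorBasis, ?_, fun i => by rw [hn, key]⟩
  have : matAbs D = (hH.eigenvectorUnitary : Matrix (Fin n) (Fin n) ℝ) *
      Matrix.diagonal (fun i => (hH.eigenvalues i) ^ (1/2 : ℝ)) *
      (star hH.eigenvectorUnitary : Matrix.unitaryGroup (Fin n) ℝ) := by
    simp only [matAbs, matPow, dif_pos hH]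
  rw [this, Matrix.trace_mul_comm, ← mul_assoc]
  have h2 : ((star hH.eigenvectorUnitary : Matrix.unitaryGroup (Fin n) ℝ) :
      Matrix (Fin n) (Fin n) ℝ) * (hH.eigenvectorUnitary : Matrix (Fin n) (Fin n) ℝ) = 1 := by
    have := Matrix.mem_unitaryGroup_iff'.1 hH.eigenvectorUnitary.2
    simpa using this
  rw [h2, one_mul, Matrix.trace_diagonal]
  refine Finset.sum_congr rfl fun i _ => ?_
  rw [← hn i, ← Real.sqrt_eq_rpow, Real.sqrt_sq (norm_nonneg _)]

lemma frob_le {n m : ℕ} (B D : Matrix (Fin m) (Fin n) ℝ) :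
    |frob B D| ≤ ‖opOf B‖ * Matrix.trace (matAbs D) := by
  obtain ⟨w, hw, -⟩ := exists_svd D
  rw [frob_eq B D w, hw, Finset.mul_sum]
  refine (Finset.abs_sum_le_sum_abs _ _).trans (Finset.sum_le_sum fun i _ => ?_)
  refine (abs_real_inner_le_norm _ _).trans ?_
  gcongr
  exact ((opOf B).le_opNorm _).trans (by simp [w.norm_eq_one])

lemma exists_frob_eq {n m : ℕ} (D : Matrix (Fin m) (Fin n) ℝ) :
    ∃ A : Matrix (Fin m) (Fin n) ℝ, ‖opOf A‖ ≤ 1 ∧ frob A D = Matrix.trace (matAbs D) := by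
  obtain ⟨w, hw, hs⟩ := exists_svd D
  let v : Fin n → Euc m := fun i => ‖opOf D (w i)‖⁻¹ • opOf D (w i)
  let T : Euc n →L[ℝ] Euc m := ∑ i, (innerSL ℝ (w i)).smulRight (v i)
  have hT : ∀ x, T x = ∑ i, ⟪w i, x⟫ • v i := by
    intro x
    simp [T]
  have horth : ∀ i j, i ≠ j → ⟪v i, v j⟫ = 0 := by
    intro i j hij
    simp only [v, inner_smul_left, inner_smul_right]
    rw [← ContinuousLinearMap.adjoint_inner_right, hs j, inner_smul_right,
      w.inner_eq_zero hij]
    simp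
  have hv1 : ∀ i, ‖v i‖ ≤ 1 := by
    intro i
    simp only [v, norm_smul, norm_inv, norm_norm]
    exact inv_mul_le_one
  have hTw : ∀ i, T (w i) = v i := by
    intro i
    rw [hT]
    simp [w.inner_eq_ite]
  refine ⟨matOf T, ?_, ?_⟩
  · rw [opOf_matOf]
    refine ContinuousLinearMap.opNorm_le_bound _ zero_le_one fun x => ?_
    rw [one_mul]
    refine le_of_sq_le_sq ?_ (norm_nonneg x)
    rw [hT, ← real_inner_self_eq_norm_sq, sum_inner]
    have : ∀ i, ⟪⟪w i, x⟫ • v i, ∑ j, ⟪w j, x⟫ • v j⟫ = ⟪w i, x⟫ ^ 2 * ‖v i‖ ^ 2 := by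
      intro i
      rw [inner_sum, Finset.sum_eq_single i]
      · rw [inner_smul_left, inner_smul_right, real_inner_self_eq_norm_sq]
        simp; ring
      · intro j _ hj
        rw [inner_smul_left, inner_smul_right, horth i j hj.symm]; simp
      · simp
    simp_rw [this]
    rw [← w.sum_sq_norm_inner_right x]
    refine Finset.sum_le_sum fun i _ => ?_
    rw [Real.norm_eq_abs, sq_abs]
    have := hv1 i
    have h0 := norm_nonneg (v i)
    have : ‖v i‖ ^ 2 ≤ 1 := by nlinarith
    nlinarith [sq_nonneg ⟪w i, x⟫]
  · rw [frob_eq _ _ w, hw, opOf_matOf]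
    refine Finset.sum_congr rfl fun i _ => ?_
    rw [hTw]
    simp only [v, inner_smul_left, real_inner_self_eq_norm_sq]
    by_cases h : ‖opOf D (w i)‖ = 0
    · simp [h]
    · simp; field_simp

lemma frob_eq_case {n m : ℕ} (B D : Matrix (Fin m) (Fin n) ℝ) (hB : ‖opOf B‖ ≤ 1)
    (h : frob B D = Matrix.trace (matAbs D)) :
    B * Bᴴ * D = D ∧ (Bᴴ * D).PosSemidef := by
  obtain ⟨w, hw, hs⟩ := exists_svd D
  rw [frob_eq B D w, hw] at h
  have hBw : ∀ x, ‖opOf B x‖ ≤ ‖x‖ := fun x =>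
    ((opOf B).le_opNorm _).trans (mul_le_of_le_one_left (norm_nonneg _) hB)
  have hBa : ∀ x, ‖(opOf B).adjoint x‖ ≤ ‖x‖ := fun x =>
    ((opOf B).adjoint.le_opNorm _).trans (mul_le_of_le_one_left (norm_nonneg _)
      (by rw [LinearIsometryEquiv.norm_map]; exact hB))
  have hle : ∀ i ∈ Finset.univ, ⟪opOf B (w i), opOf D (w i)⟫ ≤ ‖opOf D (w i)‖ := by
    intro i _
    refine (real_inner_le_norm _ _).trans ?_
    refine mul_le_of_le_one_left (norm_nonneg _) ((hBw _).trans (by simp [w.norm_eq_one]))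
  have heq := (Finset.sum_eq_sum_iff_of_le hle).1 h
  -- the key pointwise consequences
  have k1 : ∀ i, opOf D (w i) = ‖opOf D (w i)‖ • opOf B (w i) := by
    intro i
    have e := heq i (Finset.mem_univ i)
    have b1 : ‖opOf B (w i)‖ ≤ 1 := (hBw _).trans (by simp [w.norm_eq_one])
    set s := ‖opOf D (w i)‖ with hsdef
    have : ‖opOf D (w i) - s • opOf B (w i)‖ ^ 2 ≤ 0 := by
      rw [norm_sub_sq_real, inner_smul_right, real_inner_comm, e, norm_smul, ← hsdef,
        Real.norm_eq_abs, abs_of_nonneg (norm_nonneg _)]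
      have h0 : 0 ≤ s := norm_nonneg _
      have := norm_nonneg (opOf B (w i))
      have : ‖opOf B (w i)‖ ^ 2 ≤ 1 := by nlinarith
      nlinarith [sq_nonneg s, mul_le_mul_of_nonneg_left this (sq_nonneg s)]
    have : ‖opOf D (w i) - s • opOf B (w i)‖ = 0 := by
      nlinarith [norm_nonneg (opOf D (w i) - s • opOf B (w i))]
    exact sub_eq_zero.1 (norm_eq_zero.1 this)
  have k2 : ∀ i, (opOf B).adjoint (opOf D (w i)) = ‖opOf D (w i)‖ • w i := by
    intro i
    have e := heq i (Finset.mem_univ i)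
    have n1 := w.norm_eq_one i
    set s := ‖opOf D (w i)‖ with hsdef
    have a1 := hBa (opOf D (w i))
    rw [← hsdef] at a1
    have h0 : 0 ≤ s := norm_nonneg _
    have : ‖(opOf B).adjoint (opOf D (w i)) - s • w i‖ ^ 2 ≤ 0 := by
      rw [norm_sub_sq_real, inner_smul_right, ContinuousLinearMap.adjoint_inner_left,
        real_inner_comm, e, norm_smul, n1,
        Real.norm_eq_abs, abs_of_nonneg h0]
      have := norm_nonneg ((opOf B).adjoint (opOf D (w i)))
      nlinarith
    have : ‖(opOf B).adjoint (opOf D (w i)) - s • w i‖ = 0 := by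
      nlinarith [norm_nonneg ((opOf B).adjoint (opOf D (w i)) - s • w i)]
    exact sub_eq_zero.1 (norm_eq_zero.1 this)
  constructor
  · apply opOf_inj
    rw [opOf_mul, opOf_mul, opOf_conjTranspose]
    refine ContinuousLinearMap.coe_injective (w.toBasis.ext fun i => ?_)
    simp only [OrthonormalBasis.coe_toBasis, ContinuousLinearMap.coe_coe,
      ContinuousLinearMap.comp_apply]
    rw [k2, map_smul, ← k1]
  · have hx : ∀ x, opOf (Bᴴ * D) x = ∑ i, (‖opOf D (w i)‖ * ⟪w i, x⟫) • w i := by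
      intro x
      rw [opOf_mul, opOf_conjTranspose, ContinuousLinearMap.comp_apply]
      conv_lhs => rw [← w.sum_repr' x]
      simp only [map_sum, map_smul, k2, smul_smul]
      exact Finset.sum_congr rfl fun i _ => by rw [mul_comm]
    rw [← Matrix.isPositive_toEuclideanLin_iff]
    have hx' : ∀ x, Matrix.toEuclideanLin (Bᴴ * D) x
      = ∑ i, (‖opOf D (w i)‖ * ⟪w i, x⟫) • w i := hx
    constructor
    · intro x y
      simp only [hx', sum_inner, inner_sum, inner_smul_left, inner_smul_right]
      refine Finset.sum_congr rfl fun i _ => ?_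
      simp [real_inner_comm]; ring
    · intro x
      simp only [hx', sum_inner, inner_smul_left, RCLike.re_to_real]
      apply Finset.sum_nonneg
      intro i _
      simp
      nlinarith [norm_nonneg (opOf D (w i)), mul_self_nonneg ⟪w i, x⟫]

lemma frob_eq_conv {n m : ℕ} (B D : Matrix (Fin m) (Fin n) ℝ)
    (h1 : B * Bᴴ * D = D) (h2 : (Bᴴ * D).PosSemidef) :
    frob B D = Matrix.trace (matAbs D) := by
  obtain ⟨w, hw, hs⟩ := exists_svd D
  have hfrob : frob B D = (Bᴴ * D).trace := by
    unfold frob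
    rw [Matrix.trace_mul_comm]
    rw [← h2.1.eq, Matrix.conjTranspose_mul, Matrix.conjTranspose_conjTranspose]
  rw [hfrob, hw, trace_matOf _ w]
  have hPs : ∀ x y, ⟪opOf (Bᴴ * D) x, y⟫ = ⟪x, opOf (Bᴴ * D) y⟫ :=
    (Matrix.isPositive_toEuclideanLin_iff.2 h2).1
  have hPp : ∀ x, 0 ≤ ⟪opOf (Bᴴ * D) x, x⟫ :=
    (Matrix.isPositive_toEuclideanLin_iff.2 h2).2
  have hP2 : ∀ x, opOf (Bᴴ * D) (opOf (Bᴴ * D) x) = (opOf D).adjoint (opOf D x) := by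
    intro x
    have : (Bᴴ * D) * (Bᴴ * D) = Dᴴ * D := by
      conv_lhs => rw [← h2.1.eq]
      rw [h2.1.eq]
      nth_rewrite 1 [← h2.1.eq]
      rw [Matrix.conjTranspose_mul, Matrix.conjTranspose_conjTranspose]
      calc Dᴴ * B * (Bᴴ * D) = Dᴴ * (B * Bᴴ * D) := by simp only [Matrix.mul_assoc]
        _ = _ := by rw [h1]
    rw [← ContinuousLinearMap.comp_apply, ← opOf_mul, this, opOf_mul, opOf_conjTranspose]
    rfl
  refine Finset.sum_congr rfl fun i _ => ?_
  set P := opOf (Bᴴ * D)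
  set s := ‖opOf D (w i)‖ with hsd
  have hs0 : 0 ≤ s := norm_nonneg _
  have hi : P (P (w i)) = s ^ 2 • w i := by rw [hP2, hs]
  have hv : P (w i) = s • w i := by
    rcases hs0.eq_or_lt with h0 | h0
    · have : ⟪P (w i), P (w i)⟫ = 0 := by
        rw [hPs, hi, ← h0]; simp
      rw [inner_self_eq_zero.1 this, ← h0]; simp
    · have hPv : P (P (w i) - s • w i) = (-s) • (P (w i) - s • w i) := by
        rw [map_sub, hi, map_smul, smul_sub, smul_smul]
        module
      have := hPp (P (w i) - s • w i)
      rw [hPv, inner_smul_left, real_inner_self_eq_norm_sq] at this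
      simp only [conj_trivial] at this
      have : ‖P (w i) - s • w i‖ ^ 2 ≤ 0 := by nlinarith
      have : ‖P (w i) - s • w i‖ = 0 := by
        nlinarith [norm_nonneg (P (w i) - s • w i)]
      exact sub_eq_zero.1 (norm_eq_zero.1 this)
  rw [hv, inner_smul_right, real_inner_self_eq_norm_sq, w.norm_eq_one]; simp

end LinAlg

section Cutoff

lemma exists_cutoff (n : ℕ) : ∃ χ : ℕ → Euc n → ℝ, ∃ C : ℝ, 0 ≤ C ∧
    (∀ k, ContDiff ℝ 1 (χ k)) ∧ (∀ k, HasCompactSupport (χ k)) ∧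
    (∀ k x, 0 ≤ χ k x ∧ χ k x ≤ 1) ∧ (∀ x, ∀ᶠ k in atTop, χ k =ᶠ[𝓝 x] fun _ => 1) ∧
    (∀ k x, ‖fderiv ℝ (χ k) x‖ * (1 + ‖x‖) ≤ C) := by
  let b : ContDiffBump (0 : Euc n) := ⟨1, 2, one_pos, one_lt_two⟩
  have hb1 : ContDiff ℝ 1 b := b.contDiff
  have hbs : HasCompactSupport (fderiv ℝ b) := b.hasCompactSupport.fderiv (𝕜 := ℝ)
  have hcont : Continuous (fun y => ‖fderiv ℝ b y‖ * (1 + ‖y‖)) :=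
    ((hb1.continuous_fderiv one_ne_zero).norm).mul (by fun_prop)
  have hcs : HasCompactSupport (fun y => ‖fderiv ℝ b y‖ * (1 + ‖y‖)) :=
    (hbs.norm).mul_right
  obtain ⟨C, hC⟩ := hcont.bounded_above_of_compact_support hcs
  have hC' : ∀ y, ‖fderiv ℝ b y‖ * (1 + ‖y‖) ≤ C := fun y => (Real.le_norm_self _).trans (hC y)
  have hC0 : 0 ≤ C := le_trans (by positivity) (hC' 0)
  have hr : ∀ k : ℕ, (0 : ℝ) < ((k : ℝ) + 1)⁻¹ := fun k => by positivity
  refine ⟨fun k x => b (((k : ℝ) + 1)⁻¹ • x), C, hC0, ?_, ?_, ?_, ?_, ?_⟩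
  · intro k
    exact hb1.comp (contDiff_const_smul _)
  · intro k
    have := b.hasCompactSupport.comp_homeomorph (Homeomorph.smulOfNeZero _ (hr k).ne')
    exact this
  · exact fun k x => ⟨b.nonneg, b.le_one⟩
  · intro x
    obtain ⟨N, hN⟩ := exists_nat_gt ‖x‖
    filter_upwards [eventually_ge_atTop N] with k hk
    have hkx : ‖x‖ < k + 1 := by
      have : (N : ℝ) ≤ k := by exact_mod_cast hk
      linarith
    have : ∀ᶠ y in 𝓝 x, ‖y‖ < k + 1 := continuous_norm.continuousAt.eventually_lt_const hkx
    filter_upwards [this] with y hy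
    apply b.one_of_mem_closedBall
    rw [mem_closedBall_zero_iff, norm_smul, norm_inv, Real.norm_of_nonneg (by positivity)]
    show _ ≤ (1 : ℝ)
    rw [inv_mul_le_iff₀ (by positivity)]
    linarith
  · intro k x
    have h1 : HasFDerivAt (fun x => b (((k : ℝ) + 1)⁻¹ • x))
        ((((k : ℝ) + 1)⁻¹) • fderiv ℝ b (((k : ℝ) + 1)⁻¹ • x)) x := by
      have ha := (hb1.differentiable one_ne_zero (((k : ℝ) + 1)⁻¹ • x)).hasFDerivAt
      have hc := ha.comp x ((hasFDerivAt_id x).const_smul (((k : ℝ) + 1)⁻¹))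
      refine hc.congr_fderiv ?_
      ext v
      simp
    rw [h1.fderiv, norm_smul, Real.norm_of_nonneg (hr k).le]
    have := hC' (((k : ℝ) + 1)⁻¹ • x)
    rw [norm_smul, Real.norm_of_nonneg (hr k).le] at this
    have hle : ((k : ℝ) + 1)⁻¹ ≤ 1 := inv_le_one_of_one_le₀ (by linarith [k.cast_nonneg (α := ℝ)])
    refine le_trans ?_ this
    rw [mul_right_comm, mul_comm]
    gcongr
    rw [mul_add, mul_one]
    gcongr

lemma growth {n : ℕ} {F : Type*} [NormedAddCommGroup F] [NormedSpace ℝ F] {u : Euc n → F}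
    (hu : ContDiff ℝ 1 u) {K : ℝ} (hK : ∀ x, ‖fderiv ℝ u x‖ ≤ K) (x : Euc n) :
    ‖u x - u 0‖ ≤ K * ‖x‖ := by
  have := Convex.norm_image_sub_le_of_norm_fderiv_le (𝕜 := ℝ) (f := u) (s := Set.univ) (C := K)
    (x := 0) (y := x) (fun y _ => hu.differentiable one_ne_zero y) (fun y _ => hK y) convex_univ
    (Set.mem_univ _) (Set.mem_univ _)
  simpa using this

lemma exists_approx {n : ℕ} {F : Type*} [NormedAddCommGroup F] [NormedSpace ℝ F] {u : Euc n → F}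
    (hu : ContDiff ℝ 1 u) {K : ℝ} (hK : ∀ x, ‖fderiv ℝ u x‖ ≤ K) :
    ∃ v : ℕ → Euc n → F, ∃ C : ℝ, (∀ k, ContDiff ℝ 1 (v k)) ∧ (∀ k, HasCompactSupport (v k)) ∧
      (∀ k x, ‖fderiv ℝ (v k) x‖ ≤ C) ∧ (∀ x, ∀ᶠ k in atTop, v k =ᶠ[𝓝 x] u) ∧
      (∀ k x, ∃ c : ℝ, 0 ≤ c ∧ c ≤ 1 ∧ v k x = c • u x) := by
  obtain ⟨χ, C, hC0, hχ, hχs, hχ1, hχe, hχC⟩ := exists_cutoff n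
  have hK0 : 0 ≤ K := (norm_nonneg _).trans (hK 0)
  refine ⟨fun k x => χ k x • u x, K + C * (‖u 0‖ + K), fun k => (hχ k).smul hu,
    fun k => (hχs k).smul_right, ?_, ?_, fun k x => ⟨χ k x, (hχ1 k x).1, (hχ1 k x).2, rfl⟩⟩
  · intro k x
    have h1 := ((hχ k).differentiable one_ne_zero x).hasFDerivAt.smul
      (hu.differentiable one_ne_zero x).hasFDerivAt
    have hh := h1.fderiv
    have hux : ‖u x‖ ≤ (‖u 0‖ + K) * (1 + ‖x‖) := by
      have := growth hu hK x
      have h2 : ‖u x‖ ≤ ‖u x - u 0‖ + ‖u 0‖ := by simpa using norm_add_le (u x - u 0) (u 0)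
      nlinarith [norm_nonneg x, norm_nonneg (u 0), mul_nonneg (norm_nonneg x) (norm_nonneg (u 0))]
    calc ‖fderiv ℝ (fun x => χ k x • u x) x‖
        = ‖χ k x • fderiv ℝ u x + (fderiv ℝ (χ k) x).smulRight (u x)‖ := by
          rw [← hh]; rfl
      _ ≤ ‖χ k x • fderiv ℝ u x‖ + ‖(fderiv ℝ (χ k) x).smulRight (u x)‖ := norm_add_le _ _
      _ ≤ K + C * (‖u 0‖ + K) := by
          gcongr
          · rw [norm_smul, Real.norm_of_nonneg (hχ1 k x).1]
            exact (mul_le_of_le_one_left (norm_nonneg _) (hχ1 k x).2).trans (hK x)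
          · rw [ContinuousLinearMap.norm_smulRight_apply]
            calc _ ≤ ‖fderiv ℝ (χ k) x‖ * ((‖u 0‖ + K) * (1 + ‖x‖)) := by gcongr
              _ = (‖fderiv ℝ (χ k) x‖ * (1 + ‖x‖)) * (‖u 0‖ + K) := by ring
              _ ≤ _ := by gcongr; exact hχC k x
  · intro x
    filter_upwards [hχe x] with k hk
    filter_upwards [hk] with y hy
    simp [hy]

end Cutoff

section Basics

variable {n m : ℕ}

lemma fderivMat_eq (f : Euc n → Euc m) (x : Euc n) : fderivMat f x = matOf (fderiv ℝ f x) := rfl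

lemma frob_sum (A B : Matrix (Fin m) (Fin n) ℝ) : frob A B = ∑ i, ∑ j, A i j * B i j := by
  simp [frob, Matrix.trace, Matrix.mul_apply]

lemma matOf_add (S T : Euc n →L[ℝ] Euc m) : matOf (S + T) = matOf S + matOf T := by
  ext i j; simp [matOf]

lemma frob_add_left (A B D : Matrix (Fin m) (Fin n) ℝ) :
    frob (A + B) D = frob A D + frob B D := by
  simp [frob, Matrix.add_mul]

lemma frob_smul_left (c : ℝ) (A D : Matrix (Fin m) (Fin n) ℝ) :
    frob (c • A) D = c * frob A D := by
  simp [frob]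

lemma MatMeas.frob_le (M : MatMeas n m) (G : Euc n → (Euc n →L[ℝ] Euc m)) :
    ∀ᵐ x ∂M.var, ‖frob (matOf (G x)) (M.density x)‖ ≤ ‖G x‖ := by
  filter_upwards [M.norm_density] with x hx
  have := _root_.frob_le (matOf (G x)) (M.density x)
  rwa [hx, mul_one, opOf_matOf] at this

lemma MatMeas.measurable_frob (M : MatMeas n m) {G : Euc n → (Euc n →L[ℝ] Euc m)}
    (hG : Continuous G) : Measurable fun x => frob (matOf (G x)) (M.density x) := by
  simp only [frob_sum]
  refine Finset.measurable_fun_sum _ fun i _ => Finset.measurable_fun_sum _ fun j _ => ?_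
  refine Measurable.mul ?_ (M.measurable_density i j)
  refine Continuous.measurable ?_
  simp only [matOf, Matrix.of_apply]
  fun_prop

lemma MatMeas.integrable_frob (M : MatMeas n m) {G : Euc n → (Euc n →L[ℝ] Euc m)}
    (hG : Continuous G) {C : ℝ} (hC : ∀ x, ‖G x‖ ≤ C) :
    Integrable (fun x => frob (matOf (G x)) (M.density x)) M.var := by
  have := M.finite
  refine Integrable.mono' (integrable_const C) (M.measurable_frob hG).aestronglyMeasurable ?_
  filter_upwards [M.frob_le G] with x hx
  exact hx.trans (hC x)

lemma VecMeas.measurable_inner (μ : VecMeas n m) {u : Euc n → Euc m} (hu : Continuous u) :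
    Measurable fun x => ⟪u x, μ.density x⟫ :=
  hu.measurable.inner μ.measurable_density

lemma VecMeas.inner_le (μ : VecMeas n m) (u : Euc n → Euc m) :
    ∀ᵐ x ∂μ.var, ‖⟪u x, μ.density x⟫‖ ≤ ‖u x‖ := by
  filter_upwards [μ.norm_density] with x hx
  simpa [hx] using norm_inner_le_norm (𝕜 := ℝ) (u x) (μ.density x)

lemma VecMeas.integrable_growth (μ : VecMeas n m) (hμ : μ.finiteFirstMoment) (a b : ℝ) :
    Integrable (fun x => a + b * ‖x‖) μ.var := by
  have := μ.finite
  exact (integrable_const a).add (Integrable.const_mul hμ b)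

lemma norm_le_growth {u : Euc n → Euc m}
    (hu : ContDiff ℝ 1 u) {K : ℝ} (hK : ∀ x, ‖fderiv ℝ u x‖ ≤ K) (x : Euc n) :
    ‖u x‖ ≤ ‖u 0‖ + K * ‖x‖ := by
  have := growth hu hK x
  have h2 : ‖u x‖ ≤ ‖u x - u 0‖ + ‖u 0‖ := by simpa using norm_add_le (u x - u 0) (u 0)
  linarith

lemma VecMeas.integrable_inner (μ : VecMeas n m) (hμ : μ.finiteFirstMoment) {u : Euc n → Euc m}
    (hu : ContDiff ℝ 1 u) {K : ℝ} (hK : ∀ x, ‖fderiv ℝ u x‖ ≤ K) :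
    Integrable (fun x => ⟪u x, μ.density x⟫) μ.var := by
  refine Integrable.mono' (μ.integrable_growth hμ ‖u 0‖ K)
    (μ.measurable_inner hu.continuous).aestronglyMeasurable ?_
  filter_upwards [μ.inner_le u] with x hx
  exact hx.trans (norm_le_growth hu hK x)

lemma measurable_frob_of {D : Euc n → Matrix (Fin m) (Fin n) ℝ}
    (hD : ∀ i j, Measurable fun x => D x i j) {G : Euc n → (Euc n →L[ℝ] Euc m)}
    (hG : Continuous G) : Measurable fun x => frob (matOf (G x)) (D x) := by
  simp only [frob_sum]
  refine Finset.measurable_fun_sum _ fun i _ => Finset.measurable_fun_sum _ fun j _ => ?_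
  refine Measurable.mul ?_ (hD i j)
  refine Continuous.measurable ?_
  simp only [matOf, Matrix.of_apply]
  fun_prop

lemma pair_extend_gen (ν : Measure (Euc n)) [IsFiniteMeasure ν]
    (D : Euc n → Matrix (Fin m) (Fin n) ℝ) (hD : ∀ i j, Measurable fun x => D x i j)
    (hDb : ∀ᵐ x ∂ν, ∀ T : Euc n →L[ℝ] Euc m, ‖frob (matOf T) (D x)‖ ≤ ‖T‖)
    (μ : VecMeas n m) (hμ : μ.finiteFirstMoment)
    (h : ∀ v : Euc n → Euc m, ContDiff ℝ 1 v → HasCompactSupport v →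
      μ.pair v = ∫ x, frob (fderivMat v x) (D x) ∂ν) {u : Euc n → Euc m} (hu : C1b u) :
    μ.pair u = ∫ x, frob (fderivMat u x) (D x) ∂ν := by
  obtain ⟨hu1, K, hK⟩ := hu
  obtain ⟨v, C, hv1, hvs, hvC, hve, hvc⟩ := exists_approx hu1 hK
  have t1 : Tendsto (fun k => μ.pair (v k)) atTop (𝓝 (μ.pair u)) := by
    unfold VecMeas.pair
    refine tendsto_integral_of_dominated_convergence (fun x => ‖u 0‖ + K * ‖x‖)
      (fun k => (μ.measurable_inner (hv1 k).continuous).aestronglyMeasurable)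
      (μ.integrable_growth hμ _ _) (fun k => ?_) ?_
    · filter_upwards [μ.inner_le (v k)] with x hx
      refine hx.trans (le_trans ?_ (norm_le_growth hu1 hK x))
      obtain ⟨c, hc0, hc1, e⟩ := hvc k x
      rw [e, norm_smul, Real.norm_of_nonneg hc0]
      exact mul_le_of_le_one_left (norm_nonneg _) hc1
    · refine Eventually.of_forall fun x => ?_
      refine tendsto_const_nhds.congr' ?_
      filter_upwards [hve x] with k hk
      rw [hk.eq_of_nhds]
  have t2 : Tendsto (fun k => ∫ x, frob (fderivMat (v k) x) (D x) ∂ν) atTop (𝓝 (∫ x, frob (fderivMat u x) (D x) ∂ν)) := by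
    refine tendsto_integral_of_dominated_convergence (fun x => C)
      (fun k => (measurable_frob_of hD
        ((hv1 k).continuous_fderiv one_ne_zero)).aestronglyMeasurable)
      (integrable_const _) (fun k => ?_) ?_
    · filter_upwards [hDb] with x hx
      exact (hx _).trans (hvC k x)
    · refine Eventually.of_forall fun x => ?_
      refine tendsto_const_nhds.congr' ?_
      filter_upwards [hve x] with k hk
      rw [fderivMat_eq, fderivMat_eq, hk.fderiv_eq]
  refine tendsto_nhds_unique t1 (t2.congr fun k => ?_)
  exact (h (v k) (hv1 k) (hvs k)).symm

lemma pair_extend (M : MatMeas n m) (μ : VecMeas n m) (hμ : μ.finiteFirstMoment)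
    (h : ∀ v : Euc n → Euc m, ContDiff ℝ 1 v → HasCompactSupport v →
      μ.pair v = M.pair (fderivMat v)) {u : Euc n → Euc m} (hu : C1b u) :
    μ.pair u = M.pair (fderivMat u) := by
  have := M.finite
  refine pair_extend_gen M.var M.density M.measurable_density ?_ μ hμ h hu
  filter_upwards [M.norm_density] with x hx T
  have := _root_.frob_le (matOf T) (M.density x)
  rwa [hx, mul_one, opOf_matOf] at this

lemma C1z_of_compact {v : Euc n → Euc m} (h1 : ContDiff ℝ 1 v) (h2 : HasCompactSupport v) :
    C1z v := by
  refine ⟨h1, ?_⟩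
  have : HasCompactSupport (fun x => ‖fderiv ℝ v x‖) := (h2.fderiv (𝕜 := ℝ)).norm
  exact this.is_zero_at_infty

lemma C1b.norm_le {u : Euc n → Euc m} (hu : C1b u) (x : Euc n) : ‖fderiv ℝ u x‖ ≤ C1Norm u := by
  obtain ⟨_, C, hC⟩ := hu
  exact le_ciSup (f := fun x => ‖fderiv ℝ u x‖) ⟨C, by rintro _ ⟨y, rfl⟩; exact hC y⟩ x

lemma C1z.toC1b {u : Euc n → Euc m} (hu : C1z u) : C1b u := by
  refine ⟨hu.1, ?_⟩
  have hc : Continuous fun x => ‖fderiv ℝ u x‖ := (hu.1.continuous_fderiv one_ne_zero).norm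
  have hb : ∀ᶠ x in cocompact (Euc n), ‖fderiv ℝ u x‖ < 1 := hu.2.eventually_lt_const one_pos
  obtain ⟨t, ht, hts⟩ := mem_cocompact.1 hb
  obtain ⟨C, hC⟩ := ht.exists_bound_of_continuousOn hc.continuousOn
  refine ⟨max C 1, fun x => ?_⟩
  by_cases hx : x ∈ t
  · exact le_max_of_le_left (by simpa using hC x hx)
  · exact le_max_of_le_right (le_of_lt (hts hx))

end Basics

section Converse

variable {n m : ℕ}

lemma integrable_of_isNegDiv (M : MatMeas n m) (μ : VecMeas n m) (h : IsNegDiv M μ)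
    {u : Euc n → Euc m} (hu : C1z u) : Integrable (fun x => ⟪u x, μ.density x⟫) μ.var := by
  by_contra hni
  have hfin := μ.finite
  have hrepr : ∀ v : Euc n → Euc m, ContDiff ℝ 1 v → HasCompactSupport v →
      Integrable (fun x => ⟪v x, μ.density x⟫) μ.var := by
    intro v hv hvs
    obtain ⟨C, hC⟩ := hv.continuous.bounded_above_of_compact_support hvs
    refine Integrable.mono' (integrable_const C)
      (μ.measurable_inner hv.continuous).aestronglyMeasurable ?_
    filter_upwards [μ.inner_le v] with x hx
    exact hx.trans (hC x)
  have hzero : ∀ w : Euc n → Euc m, C1z w →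
      ¬ Integrable (fun x => ⟪w x, μ.density x⟫) μ.var → M.pair (fderivMat w) = 0 := by
    intro w hw hn
    rw [← h w hw]
    exact integral_undef hn
  have hpair : ∀ v : Euc n → Euc m, ContDiff ℝ 1 v → HasCompactSupport v → μ.pair v = 0 := by
    intro v hv hvs
    have hvz := C1z_of_compact hv hvs
    have hder : ∀ x, fderiv ℝ (fun x => u x + v x) x = fderiv ℝ u x + fderiv ℝ v x := fun x =>
      fderiv_fun_add (hu.1.differentiable one_ne_zero x) (hv.differentiable one_ne_zero x)
    have huv : C1z (fun x => u x + v x) := by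
      refine ⟨hu.1.add hv, ?_⟩
      have h3 := hu.2.add hvz.2
      rw [add_zero] at h3
      refine squeeze_zero (fun _ => norm_nonneg _) (fun x => ?_) h3
      rw [hder]
      exact norm_add_le _ _
    have hni2 : ¬ Integrable (fun x => ⟪u x + v x, μ.density x⟫) μ.var := by
      intro hi
      apply hni
      have := hi.sub (hrepr v hv hvs)
      refine this.congr (Eventually.of_forall fun x => ?_)
      simp [inner_add_left]
    have e1 := hzero _ hu hni
    have e2 := hzero _ huv hni2
    obtain ⟨C1, hC1⟩ := hu.toC1b.2
    obtain ⟨C2, hC2⟩ := hvz.toC1b.2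
    have e3 : M.pair (fderivMat fun x => u x + v x)
        = M.pair (fderivMat u) + M.pair (fderivMat v) := by
      unfold MatMeas.pair
      rw [← integral_add]
      · refine integral_congr_ae (Eventually.of_forall fun x => ?_)
        simp only [fderivMat_eq, hder, matOf_add, frob_add_left]
      · exact M.integrable_frob (hu.1.continuous_fderiv one_ne_zero) hC1
      · exact M.integrable_frob (hv.continuous_fderiv one_ne_zero) hC2
    rw [h v hvz]
    linarith
  have hdint : Integrable μ.density μ.var := by
    refine Integrable.mono' (integrable_const 1) μ.measurable_density.aestronglyMeasurable ?_
    filter_upwards [μ.norm_density] with x hx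
    exact hx.le
  have hz : ∀ᵐ x ∂μ.var, μ.density x = 0 := by
    refine ae_eq_zero_of_integral_contDiff_smul_eq_zero hdint.locallyIntegrable
      fun g hg hgs => ?_
    refine ext_inner_left ℝ fun e => ?_
    have hgi : Integrable (fun x => g x • μ.density x) μ.var := by
      obtain ⟨C, hC⟩ := hg.continuous.bounded_above_of_compact_support hgs
      exact hdint.bdd_smul C hg.continuous.aestronglyMeasurable (Eventually.of_forall hC)
    rw [← integral_inner hgi, inner_zero_right]
    have := hpair (fun x => g x • e) ((hg.of_le (by simp)).smul contDiff_const) hgs.smul_right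
    rw [← this]
    unfold VecMeas.pair
    simp [inner_smul_left, inner_smul_right]
  have hF : ∀ᵐ x ∂μ.var, False := by
    filter_upwards [hz, μ.norm_density] with x h1 h2
    rw [h1] at h2
    simp at h2
  have hv0 : μ.var = 0 := by
    rw [ae_iff] at hF
    simpa using hF
  apply hni
  rw [hv0]
  exact integrable_zero_measure

/-- A smooth substitute of the norm. -/
def jap (n : ℕ) (x : Euc n) : ℝ := Real.sqrt (1 + ‖x‖ ^ 2)

lemma jap_contDiff (n : ℕ) : ContDiff ℝ 1 (jap n) := by
  unfold jap
  refine ContDiff.sqrt ?_ fun x => by positivity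
  exact contDiff_const.add (contDiff_norm_sq ℝ)

lemma jap_deriv (n : ℕ) (x : Euc n) : ‖fderiv ℝ (jap n) x‖ ≤ 1 := by
  have : LipschitzWith 1 (jap n) := by
    refine LipschitzWith.of_le_add fun x y => ?_
    unfold jap
    rw [dist_eq_norm]
    refine Real.sqrt_le_iff.2 ⟨by positivity, ?_⟩
    have h1 : ‖x‖ ≤ ‖y‖ + ‖x - y‖ := by
      have := norm_add_le y (x - y); simpa using this
    have h2 : Real.sqrt (1 + ‖y‖ ^ 2) ^ 2 = 1 + ‖y‖ ^ 2 := Real.sq_sqrt (by positivity)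
    have h3 : ‖y‖ ≤ Real.sqrt (1 + ‖y‖ ^ 2) := Real.le_sqrt_of_sq_le (by linarith)
    have h4 := norm_nonneg (x - y)
    have h5 := norm_nonneg x
    nlinarith [mul_le_mul_of_nonneg_right h3 h4]
  exact norm_fderiv_le_of_lipschitz ℝ this

lemma firstMoment_of_integrable (μ : VecMeas n m)
    (h : ∀ u : Euc n → Euc m, C1z u → Integrable (fun x => ⟪u x, μ.density x⟫) μ.var) :
    μ.finiteFirstMoment := by
  have hfin := μ.finite
  by_contra hni
  have hJinf : ∫⁻ x, ENNReal.ofReal (jap n x) ∂μ.var = ⊤ := by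
    by_contra hne
    apply hni
    unfold VecMeas.finiteFirstMoment
    refine ⟨continuous_norm.aestronglyMeasurable, ?_⟩
    rw [hasFiniteIntegral_iff_norm]
    refine lt_of_le_of_lt (lintegral_mono fun x => ?_) (lt_top_iff_ne_top.2 hne)
    refine ENNReal.ofReal_le_ofReal ?_
    rw [norm_norm]
    exact Real.le_sqrt_of_sq_le (by linarith)
  obtain ⟨v, C, hv1, hvs, hvC, hve, hvc⟩ := exists_approx (jap_contDiff n) (jap_deriv n)
  have hj0 : ∀ x, 0 ≤ jap n x := fun x => Real.sqrt_nonneg _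
  have hv0 : ∀ k x, 0 ≤ v k x := by
    intro k x
    obtain ⟨c, hc0, hc1, e⟩ := hvc k x
    rw [e]
    exact mul_nonneg hc0 (hj0 x)
  have hvj : ∀ k x, v k x ≤ jap n x := by
    intro k x
    obtain ⟨c, hc0, hc1, e⟩ := hvc k x
    rw [e]
    exact mul_le_of_le_one_left (hj0 x) hc1
  have hC0 : 0 ≤ C := (norm_nonneg _).trans (hvC 0 0)
  have hex : ∀ k : ℕ, ∃ N, (4 : ENNReal) ^ k ≤ ∫⁻ x, ENNReal.ofReal (v N x) ∂μ.var := by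
    intro k
    by_contra hcon
    push Not at hcon
    have hF := lintegral_liminf_le (μ := μ.var) (u := atTop) (f := fun N x => ENNReal.ofReal (v N x))
      (fun N => (hv1 N).continuous.measurable.ennreal_ofReal)
    have hl : ∀ x, liminf (fun N => ENNReal.ofReal (v N x)) atTop = ENNReal.ofReal (jap n x) := by
      intro x
      refine Tendsto.liminf_eq ?_
      refine tendsto_const_nhds.congr' ?_
      filter_upwards [hve x] with N hN
      rw [hN.eq_of_nhds]
    simp only [hl, hJinf] at hF
    have h2 : liminf (fun N => ∫⁻ x, ENNReal.ofReal (v N x) ∂μ.var) atTop ≤ 4 ^ k := by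
      refine liminf_le_of_frequently_le' (Frequently.of_forall fun N => (hcon N).le)
    have := hF.trans h2
    exact absurd this (by simp)
  choose N hN using hex
  let c : ℕ → ℝ := fun k => (1 / 2) ^ k
  have hc0 : ∀ k, 0 ≤ c k := fun k => by positivity
  have hcs : Summable c := summable_geometric_two
  let hk : ℕ → Euc n → ℝ := fun k x => c k * v (N k) x
  let hk' : ℕ → Euc n → (Euc n →L[ℝ] ℝ) := fun k x => c k • fderiv ℝ (v (N k)) x
  have hder : ∀ k x, HasFDerivAt (hk k) (hk' k x) x := fun k x =>
    ((hv1 (N k)).differentiable one_ne_zero x).hasFDerivAt.const_mul (c k)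
  have hbd : ∀ k x, ‖hk' k x‖ ≤ c k * C := by
    intro k x
    simp only [hk', norm_smul, Real.norm_of_nonneg (hc0 k)]
    exact mul_le_mul_of_nonneg_left (hvC _ _) (hc0 k)
  have hsC : Summable fun k => c k * C := hcs.mul_right C
  have hsum : ∀ x, Summable fun k => hk k x := by
    intro x
    refine Summable.of_nonneg_of_le (fun k => mul_nonneg (hc0 k) (hv0 _ _)) (fun k => ?_)
      (hcs.mul_right (jap n x))
    exact mul_le_mul_of_nonneg_left (hvj _ _) (hc0 k)
  let g : Euc n → ℝ := fun x => ∑' k, hk k x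
  have hg : ∀ x, HasFDerivAt g (∑' k, hk' k x) x := fun x =>
    hasFDerivAt_tsum hsC hder hbd (hsum 0) x
  have hgd : fderiv ℝ g = fun x => ∑' k, hk' k x := funext fun x => (hg x).fderiv
  have hg1 : ContDiff ℝ 1 g := by
    rw [contDiff_one_iff_fderiv]
    refine ⟨fun x => (hg x).differentiableAt, ?_⟩
    rw [hgd]
    refine continuous_tsum (fun k => ?_) hsC hbd
    exact ((hv1 (N k)).continuous_fderiv one_ne_zero).const_smul (c k)
  have hgz : Tendsto (fun x => fderiv ℝ g x) (cocompact (Euc n)) (𝓝 0) := by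
    rw [hgd]
    have := tendsto_tsum_of_dominated_convergence (𝓕 := cocompact (Euc n))
      (f := fun x k => hk' k x) (g := fun _ => 0) hsC (fun k => ?_)
      (Eventually.of_forall fun x k => hbd k x)
    · simpa using this
    · have : HasCompactSupport (hk' k) := ((hvs (N k)).fderiv (𝕜 := ℝ)).comp_left
        (g := fun T => c k • T) (smul_zero _)
      exact this.is_zero_at_infty
  have hgi : ∀ i, Integrable (fun x => g x * μ.density x i) μ.var := by
    intro i
    have hu : C1z (fun x => g x • (EuclideanSpace.single i (1 : ℝ) : Euc m)) := by
      refine ⟨hg1.smul contDiff_const, ?_⟩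
      have e : ∀ x, fderiv ℝ (fun x => g x • (EuclideanSpace.single i (1 : ℝ) : Euc m)) x
          = (fderiv ℝ g x).smulRight (EuclideanSpace.single i (1 : ℝ)) := fun x =>
        ((hg x).differentiableAt.hasFDerivAt.smul_const _).fderiv
      simp only [e, ContinuousLinearMap.norm_smulRight_apply]
      simpa using hgz.norm
    refine (h _ hu).congr (Eventually.of_forall fun x => ?_)
    simp [inner_smul_left, EuclideanSpace.inner_single_left]
  have hgint : Integrable g μ.var := by
    have hs : Integrable (fun x => ∑ i, ‖g x * μ.density x i‖) μ.var :=
      integrable_finsetSum _ fun i _ => (hgi i).norm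
    refine Integrable.mono' hs hg1.continuous.aestronglyMeasurable ?_
    filter_upwards [μ.norm_density] with x hx
    simp only [norm_mul]
    rw [← Finset.mul_sum]
    refine le_mul_of_one_le_right (norm_nonneg _) ?_
    rw [← hx]
    have e : μ.density x = ∑ i, EuclideanSpace.single i (μ.density x i) := by
      ext k; simp [Finset.sum_apply, Pi.single_apply]
    conv_lhs => rw [e]
    refine (norm_sum_le _ _).trans (Finset.sum_le_sum fun i _ => ?_)
    simp
  have hlt := hgint.lintegral_lt_top
  have hge : ∀ k : ℕ, (2 : ENNReal) ^ k ≤ ∫⁻ x, ENNReal.ofReal (g x) ∂μ.var := by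
    intro k
    calc (2 : ENNReal) ^ k = ENNReal.ofReal (c k) * 4 ^ k := by
          have : (4 : ENNReal) ^ k = ENNReal.ofReal (4 ^ k) := by
            rw [ENNReal.ofReal_pow (by norm_num)]; simp
          rw [this, ← ENNReal.ofReal_mul (hc0 k)]
          have : c k * 4 ^ k = 2 ^ k := by
            simp only [c]; rw [← mul_pow]; norm_num
          rw [this, ENNReal.ofReal_pow (by norm_num)]; simp
      _ ≤ ENNReal.ofReal (c k) * ∫⁻ x, ENNReal.ofReal (v (N k) x) ∂μ.var := by
          gcongr; exact hN k
      _ = ∫⁻ x, ENNReal.ofReal (hk k x) ∂μ.var := by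
          rw [← lintegral_const_mul _ (hv1 (N k)).continuous.measurable.ennreal_ofReal]
          refine lintegral_congr fun x => ?_
          rw [ENNReal.ofReal_mul (hc0 k)]
      _ ≤ _ := by
          refine lintegral_mono fun x => ENNReal.ofReal_le_ofReal ?_
          exact (hsum x).le_tsum k fun j _ => mul_nonneg (hc0 j) (hv0 _ _)
  have htop : Tendsto (fun k : ℕ => (2 : ENNReal) ^ k) atTop (𝓝 ⊤) :=
    ENNReal.tendsto_pow_atTop_nhds_top_iff.2 (by norm_num)
  have := le_of_tendsto' htop hge
  exact absurd hlt (not_lt.2 this)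

lemma pair_mass (M : MatMeas n m) (f : Euc n → Euc m)
    (hM : ∀ᵐ x ∂M.var, frob (fderivMat f x) (M.density x) = 1) :
    M.pair (fderivMat f) = M.tvNorm := by
  unfold MatMeas.pair MatMeas.tvNorm
  rw [integral_congr_ae hM]
  simp [Measure.real]

lemma pair_le_mass (M : MatMeas n m) (u : Euc n → Euc m) (hu : C1b u) (h1 : C1Norm u ≤ 1) :
    M.pair (fderivMat u) ≤ M.tvNorm := by
  have := M.finite
  unfold MatMeas.pair MatMeas.tvNorm
  have e : (M.var Set.univ).toReal = ∫ _x, (1 : ℝ) ∂M.var := by simp [Measure.real]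
  rw [e]
  refine integral_mono_ae (M.integrable_frob (hu.1.continuous_fderiv one_ne_zero) hu.norm_le)
    (integrable_const _) ?_
  filter_upwards [M.frob_le (fderiv ℝ u)] with x hx
  exact ((Real.le_norm_self _).trans hx).trans ((hu.norm_le x).trans h1)

theorem converse_part (f : Euc n → Euc m)
    (hf : C1b f) (hf1 : C1Norm f = 1) (M : MatMeas n m)
    (hM : ∀ᵐ x ∂M.var,
        fderivMat f x * (fderivMat f x)ᴴ * M.density x = M.density x ∧
        ((fderivMat f x)ᴴ * M.density x).PosSemidef)
    (μ : VecMeas n m) (h : IsNegDiv M μ) :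
      μ.totalZero ∧ μ.finiteFirstMoment ∧ Jsup μ = μ.pair f := by
  have hmom : μ.finiteFirstMoment :=
    firstMoment_of_integrable μ fun u hu => integrable_of_isNegDiv M μ h hu
  have hfin := μ.finite
  have hdint : Integrable μ.density μ.var := by
    refine Integrable.mono' (integrable_const 1) μ.measurable_density.aestronglyMeasurable ?_
    filter_upwards [μ.norm_density] with x hx
    exact hx.le
  have hext : ∀ u, C1b u → μ.pair u = M.pair (fderivMat u) := fun u hu =>
    pair_extend M μ hmom (fun v hv hvs => h v (C1z_of_compact hv hvs)) hu
  refine ⟨?_, hmom, ?_⟩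
  · unfold VecMeas.totalZero
    refine ext_inner_left ℝ fun e => ?_
    rw [← integral_inner hdint, inner_zero_right]
    have := hext (fun _ => e) ⟨contDiff_const, 0, fun x => by simp⟩
    unfold VecMeas.pair MatMeas.pair at this
    rw [this]
    have hz : ∀ x, fderivMat (fun _ : Euc n => e) x = 0 := by
      intro x; ext i j; simp [fderivMat]
    simp [hz, frob]
  · have hmass : M.pair (fderivMat f) = M.tvNorm := by
      apply pair_mass
      filter_upwards [hM, M.norm_density] with x hx h1
      rw [frob_eq_conv _ _ hx.1 hx.2, h1]
    refine IsGreatest.csSup_eq ⟨⟨f, hf, hf1.le, rfl⟩, ?_⟩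
    rintro r ⟨u, hu, hu1, rfl⟩
    rw [hext u hu, hext f hf, hmass]
    exact pair_le_mass M u hu hu1

end Converse

section Riesz

open scoped CompactlySupported

variable {n m : ℕ}

lemma cc_integrable (ν : Measure (Euc n)) [IsFiniteMeasureOnCompacts ν] (φ : C_c(Euc n, ℝ)) :
    Integrable φ ν :=
  φ.continuous.integrable_of_hasCompactSupport φ.hasCompactSupport

lemma cc_bdd {F : Type*} [NormedAddCommGroup F] (φ : C_c(Euc n, F)) : ∃ C : ℝ, ∀ x, ‖φ x‖ ≤ C :=
  φ.continuous.bounded_above_of_compact_support φ.hasCompactSupport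

lemma cc_mul_integrable {ν : Measure (Euc n)} (φ : C_c(Euc n, ℝ)) {h : Euc n → ℝ}
    (hh : Integrable h ν) : Integrable (fun x => φ x * h x) ν := by
  obtain ⟨C, hC⟩ := cc_bdd φ
  exact hh.bdd_mul φ.continuous.aestronglyMeasurable (Eventually.of_forall hC)

/-- Riesz-Markov-Kakutani for a linear functional which is nonnegative. -/
lemma exists_riesz (Λ : C_c(Euc n, ℝ) →ₗ[ℝ] ℝ) (h : ∀ φ, (∀ x, 0 ≤ φ x) → 0 ≤ Λ φ) :
    ∃ ν : Measure (Euc n), IsFiniteMeasureOnCompacts ν ∧ ν.Regular ∧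
      ∀ φ : C_c(Euc n, ℝ), ∫ x, φ x ∂ν = Λ φ := by
  let Λ' : C_c(Euc n, ℝ) →ₚ[ℝ] ℝ := PositiveLinearMap.mk₀ Λ (fun φ hφ => h φ fun x => hφ x)
  refine ⟨RealRMK.rieszMeasure Λ', inferInstance, inferInstance, fun φ => ?_⟩
  rw [RealRMK.integral_rieszMeasure]
  rfl

lemma riesz_finite (Λ : C_c(Euc n, ℝ) →ₗ[ℝ] ℝ) {J : ℝ} (hJ : 0 ≤ J)
    (hc : ∀ φ : C_c(Euc n, ℝ), (∀ x, φ x ≤ 1) → Λ φ ≤ J)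
    (ν : Measure (Euc n)) [ν.Regular] (hν : ∀ φ : C_c(Euc n, ℝ), ∫ x, φ x ∂ν = Λ φ) :
    ν Set.univ ≤ ENNReal.ofReal J := by
  rw [isOpen_univ.measure_eq_iSup_isCompact]
  refine iSup₂_le fun K _ => iSup_le fun hK => ?_
  obtain ⟨g, hg1, -, hgs, hg01⟩ := exists_continuous_one_zero_of_isCompact hK isClosed_empty
    (Set.disjoint_empty K)
  let φ : C_c(Euc n, ℝ) := ⟨g, hgs⟩
  have h1 : ∫ x, φ x ∂ν ≤ J := by
    rw [hν]; exact hc φ fun x => (hg01 x).2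
  have hi : Integrable φ ν := cc_integrable ν φ
  have h2 : (ν.real K) ≤ ∫ x, φ x ∂ν := by
    have e : ν.real K = ∫ x in K, φ x ∂ν := by
      have : ∫ x in K, φ x ∂ν = ∫ _x in K, (1 : ℝ) ∂ν :=
        setIntegral_congr_fun hK.measurableSet fun x hx => hg1 hx
      rw [this]; simp
    rw [e]
    exact setIntegral_le_integral hi (Eventually.of_forall fun x => (hg01 x).1)
  rw [← ENNReal.ofReal_toReal hK.measure_lt_top.ne]
  exact ENNReal.ofReal_le_ofReal (h2.trans h1)

lemma regular_add (ν₁ ν₂ : Measure (Euc n)) [IsFiniteMeasureOnCompacts ν₁]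
    [IsFiniteMeasureOnCompacts ν₂] : (ν₁ + ν₂).Regular := by
  have h : IsFiniteMeasureOnCompacts (ν₁ + ν₂) :=
    ⟨fun K hK => by
      rw [Measure.add_apply]
      exact ENNReal.add_lt_top.2 ⟨hK.measure_lt_top, hK.measure_lt_top⟩⟩
  have h2 : IsLocallyFiniteMeasure (ν₁ + ν₂) := isLocallyFiniteMeasure_of_isFiniteMeasureOnCompacts
  infer_instance

lemma exists_density (Λ ℓ : C_c(Euc n, ℝ) →ₗ[ℝ] ℝ) (K : NNReal)
    (hℓ : ∀ φ, (∀ x, 0 ≤ φ x) → |ℓ φ| ≤ K * Λ φ)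
    (ν : Measure (Euc n)) [IsFiniteMeasure ν]
    (hν : ∀ φ : C_c(Euc n, ℝ), ∫ x, φ x ∂ν = Λ φ) :
    ∃ d : Euc n → ℝ, Measurable d ∧ Integrable d ν ∧
      ∀ φ : C_c(Euc n, ℝ), ∫ x, φ x * d x ∂ν = ℓ φ := by
  obtain ⟨ν₁, hf1, hr1, hν₁⟩ := exists_riesz ((K : ℝ) • Λ + ℓ) (fun φ hφ => by
    have := hℓ φ hφ
    rw [abs_le] at this
    simp; linarith)
  obtain ⟨ν₂, hf2, hr2, hν₂⟩ := exists_riesz ((K : ℝ) • Λ - ℓ) (fun φ hφ => by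
    have := hℓ φ hφ
    rw [abs_le] at this
    simp; linarith)
  have hsum : ν₁ + ν₂ = (2 * K) • ν := by
    have := regular_add ν₁ ν₂
    refine Measure.ext_of_integral_eq_on_compactlySupported fun φ => ?_
    rw [integral_add_measure (cc_integrable _ φ) (cc_integrable _ φ), hν₁, hν₂,
      integral_smul_nnreal_measure, hν]
    simp [NNReal.smul_def]
    ring
  have hle : ν₁ ≤ (2 * K) • ν := by
    rw [← hsum]; exact Measure.le_add_right le_rfl
  have hfin1 : IsFiniteMeasure ν₁ := isFiniteMeasure_of_le _ hle
  have hac : ν₁ ≪ ν := (Measure.absolutelyContinuous_of_le hle).trans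
    (Measure.smul_absolutelyContinuous)
  refine ⟨fun x => (ν₁.rnDeriv ν x).toReal - K, ?_, ?_, ?_⟩
  · exact (Measure.measurable_rnDeriv _ _).ennreal_toReal.sub_const _
  · exact Measure.integrable_toReal_rnDeriv.sub (integrable_const _)
  · intro φ
    have e1 : ∫ x, φ x * (ν₁.rnDeriv ν x).toReal ∂ν = ∫ x, φ x ∂ν₁ := by
      rw [← integral_rnDeriv_smul hac]
      simp [mul_comm]
    simp only [mul_sub]
    rw [integral_sub (cc_mul_integrable φ Measure.integrable_toReal_rnDeriv)
      (cc_mul_integrable φ (integrable_const _)), e1, hν₁, integral_mul_const, hν]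
    simp
    ring

lemma ae_nonneg_of_cc (ν : Measure (Euc n)) [IsFiniteMeasure ν] (h : Euc n → ℝ)
    (hm : Measurable h) (hi : Integrable h ν)
    (hh : ∀ φ : C_c(Euc n, ℝ), (∀ x, 0 ≤ φ x) → 0 ≤ ∫ x, φ x * h x ∂ν) :
    ∀ᵐ x ∂ν, 0 ≤ h x := by
  let ℓ : C_c(Euc n, ℝ) →ₗ[ℝ] ℝ :=
    { toFun := fun φ => ∫ x, φ x * h x ∂ν
      map_add' := fun φ ψ => by
        rw [← integral_add (cc_mul_integrable φ hi) (cc_mul_integrable ψ hi)]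
        simp [add_mul]
      map_smul' := fun c φ => by
        simp only [RingHom.id_apply, smul_eq_mul]
        rw [← integral_const_mul]
        simp [mul_assoc] }
  obtain ⟨ρ, hρf, hρr, hρ⟩ := exists_riesz ℓ hh
  have hp : Integrable (fun x => (ENNReal.ofReal (h x)).toReal) ν := by
    simp only [ENNReal.toReal_ofReal']
    exact hi.pos_part
  have hn : Integrable (fun x => (ENNReal.ofReal (-h x)).toReal) ν := by
    simp only [ENNReal.toReal_ofReal']
    exact hi.neg_part
  have hmp : Measurable fun x => ENNReal.ofReal (h x) := hm.ennreal_ofReal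
  have hmn : Measurable fun x => ENNReal.ofReal (-h x) := hm.neg.ennreal_ofReal
  have f1 : IsFiniteMeasure (ν.withDensity fun x => ENNReal.ofReal (h x)) :=
    isFiniteMeasure_withDensity_ofReal hi.2
  have f2 : IsFiniteMeasure (ν.withDensity fun x => ENNReal.ofReal (-h x)) :=
    isFiniteMeasure_withDensity_ofReal hi.neg.2
  have e : ρ + ν.withDensity (fun x => ENNReal.ofReal (-h x))
      = ν.withDensity (fun x => ENNReal.ofReal (h x)) := by
    have := regular_add ρ (ν.withDensity (fun x => ENNReal.ofReal (-h x)))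
    refine Measure.ext_of_integral_eq_on_compactlySupported fun φ => ?_
    rw [integral_add_measure (cc_integrable _ φ) (cc_integrable _ φ), hρ,
      integral_withDensity_eq_integral_toReal_smul hmn (Eventually.of_forall fun _ => by simp),
      integral_withDensity_eq_integral_toReal_smul hmp (Eventually.of_forall fun _ => by simp)]
    show ∫ x, φ x * h x ∂ν + _ = _
    simp only [smul_eq_mul]
    have i1 : Integrable (fun x => (ENNReal.ofReal (-h x)).toReal * φ x) ν := by
      simpa [mul_comm] using cc_mul_integrable φ hn
    rw [← integral_add (cc_mul_integrable φ hi) i1]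
    refine integral_congr_ae (Eventually.of_forall fun x => ?_)
    simp only [ENNReal.toReal_ofReal']
    rcases le_total 0 (h x) with h0 | h0
    · rw [max_eq_left h0, max_eq_right (by linarith)]; ring
    · rw [max_eq_right h0, max_eq_left (by linarith)]; ring
  have hle : ν.withDensity (fun x => ENNReal.ofReal (-h x))
      ≤ ν.withDensity (fun x => ENNReal.ofReal (h x)) := by
    rw [← e]; exact Measure.le_add_left le_rfl
  have := ae_le_of_forall_setLIntegral_le_of_sigmaFinite (μ := ν) hmn
    (g := fun x => ENNReal.ofReal (h x)) (fun s hs _ => by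
      rw [← withDensity_apply _ hs, ← withDensity_apply _ hs]
      exact hle s)
  filter_upwards [this] with x hx
  by_contra hneg
  push Not at hneg
  rw [ENNReal.ofReal_of_nonpos hneg.le] at hx
  have := ENNReal.ofReal_eq_zero.1 (le_antisymm hx zero_le)
  linarith

/-- The function `x ↦ φ x • A`. -/
def ccSmul (A : Euc n →L[ℝ] Euc m) : C_c(Euc n, ℝ) →ₗ[ℝ] C_c(Euc n, Euc n →L[ℝ] Euc m) where
  toFun φ := ⟨⟨fun x => φ x • A, by fun_prop⟩,
    φ.hasCompactSupport.smul_right (f' := fun _ => A)⟩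
  map_add' φ ψ := by ext1 x; exact add_smul (φ x) (ψ x) A
  map_smul' c φ := by ext1 x; exact mul_smul c (φ x) A

lemma ccSmul_apply (A : Euc n →L[ℝ] Euc m) (φ : C_c(Euc n, ℝ)) (x : Euc n) :
    ccSmul A φ x = φ x • A := rfl

lemma clm_decomp (T : Euc n →L[ℝ] Euc m) :
    T = ∑ i, ∑ j, matOf T i j • opOf (Matrix.single i j (1 : ℝ)) := by
  conv_lhs => rw [← opOf_matOf T, Matrix.matrix_eq_sum_single (matOf T)]
  unfold opOf
  simp only [map_sum]
  refine Finset.sum_congr rfl fun i _ => Finset.sum_congr rfl fun j _ => ?_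
  rw [← map_smul, ← map_smul, Matrix.smul_single, smul_eq_mul, mul_one]

lemma matOf_smul (c : ℝ) (T : Euc n →L[ℝ] Euc m) : matOf (c • T) = c • matOf T := by
  ext i j; simp [matOf]

lemma exists_matrix_density (L : C_c(Euc n, Euc n →L[ℝ] Euc m) →ₗ[ℝ] ℝ)
    (Λ : C_c(Euc n, ℝ) →ₗ[ℝ] ℝ) {J : ℝ} (hJ : 0 ≤ J)
    (hb : ∀ (G : C_c(Euc n, Euc n →L[ℝ] Euc m)) (φ : C_c(Euc n, ℝ)),
      (∀ x, ‖G x‖ ≤ φ x) → L G ≤ Λ φ)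
    (hc : ∀ φ : C_c(Euc n, ℝ), (∀ x, φ x ≤ 1) → Λ φ ≤ J) :
    ∃ ν : Measure (Euc n), ∃ D : Euc n → Matrix (Fin m) (Fin n) ℝ, IsFiniteMeasure ν ∧
      (ν Set.univ).toReal ≤ J ∧ (∀ i j, Measurable fun x => D x i j) ∧
      (∀ G, ∫ x, frob (matOf (G x)) (D x) ∂ν = L G) ∧
      (∀ᵐ x ∂ν, ∀ T : Euc n →L[ℝ] Euc m, ‖T‖ ≤ 1 → frob (matOf T) (D x) ≤ 1) := by
  have hpos : ∀ φ : C_c(Euc n, ℝ), (∀ x, 0 ≤ φ x) → 0 ≤ Λ φ := by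
    intro φ hφ
    have := hb 0 φ (fun x => by simpa using hφ x)
    simpa using this
  obtain ⟨ν, -, hreg, hν⟩ := exists_riesz Λ hpos
  have hmass := riesz_finite Λ hJ hc ν hν
  have hfin : IsFiniteMeasure ν := ⟨hmass.trans_lt ENNReal.ofReal_lt_top⟩
  have hLA : ∀ (A : Euc n →L[ℝ] Euc m) (φ : C_c(Euc n, ℝ)), (∀ x, 0 ≤ φ x) →
      |L (ccSmul A φ)| ≤ ‖A‖₊ * Λ φ := by
    intro A φ hφ
    have h1 : ∀ B : Euc n →L[ℝ] Euc m, L (ccSmul B φ) ≤ ‖B‖ * Λ φ := by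
      intro B
      have := hb (ccSmul B φ) (‖B‖ • φ) (fun x => by
        rw [ccSmul_apply, norm_smul, Real.norm_of_nonneg (hφ x)]
        simp [mul_comm])
      simpa using this
    have h2 : ccSmul (-A) φ = (-1 : ℝ) • ccSmul A φ := by
      ext1 x
      show φ x • (-A) = (-1 : ℝ) • (φ x • A)
      rw [smul_neg]; exact (neg_one_smul ℝ (φ x • A)).symm
    rw [abs_le]
    constructor
    · have := h1 (-A)
      rw [h2, map_smul, norm_neg, smul_eq_mul] at this
      simp only [coe_nnnorm]
      linarith
    · exact h1 A
  have hd : ∀ i j, ∃ d : Euc n → ℝ, Measurable d ∧ Integrable d ν ∧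
      ∀ φ : C_c(Euc n, ℝ), ∫ x, φ x * d x ∂ν
        = L (ccSmul (opOf (Matrix.single i j (1 : ℝ))) φ) := by
    intro i j
    exact exists_density Λ (L ∘ₗ ccSmul (opOf (Matrix.single i j (1 : ℝ)))) _
      (hLA _) ν hν
  choose d hdm hdi hd using hd
  let entry : Fin m → Fin n → C_c(Euc n, Euc n →L[ℝ] Euc m) → C_c(Euc n, ℝ) := fun i j G =>
    ⟨⟨fun x => matOf (G x) i j, by simp only [matOf, Matrix.of_apply]; fun_prop⟩,
      G.hasCompactSupport.comp_left (g := fun T => matOf T i j) (by simp [matOf])⟩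
  have hentry : ∀ i j G x, entry i j G x = matOf (G x) i j := fun i j G x => rfl
  have hdec : ∀ G, G = ∑ i, ∑ j, ccSmul (opOf (Matrix.single i j (1 : ℝ))) (entry i j G) := by
    intro G
    ext1 x
    simp only [CompactlySupportedContinuousMap.coe_sum, Finset.sum_apply, ccSmul_apply, hentry]
    exact clm_decomp (G x)
  have hL : ∀ G, ∫ x, frob (matOf (G x)) (Matrix.of fun i j => d i j x) ∂ν = L G := by
    intro G
    conv_rhs => rw [hdec G]
    simp only [map_sum]
    have e : ∫ x, frob (matOf (G x)) (Matrix.of fun i j => d i j x) ∂ν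
        = ∫ x, ∑ i, ∑ j, entry i j G x * d i j x ∂ν := by
      simp only [frob_sum, Matrix.of_apply, hentry]
    rw [e, integral_finsetSum _ fun i _ => integrable_finsetSum _ fun j _ =>
      cc_mul_integrable (entry i j G) (hdi i j)]
    refine Finset.sum_congr rfl fun i _ => ?_
    rw [integral_finsetSum _ fun j _ => cc_mul_integrable (entry i j G) (hdi i j)]
    exact Finset.sum_congr rfl fun j _ => hd i j (entry i j G)
  refine ⟨ν, fun x => Matrix.of fun i j => d i j x, hfin, ?_, fun i j => hdm i j, hL, ?_⟩
  · exact ENNReal.toReal_le_of_le_ofReal hJ hmass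
  · have hT : ∀ T : Euc n →L[ℝ] Euc m, ‖T‖ ≤ 1 →
        ∀ᵐ x ∂ν, frob (matOf T) (Matrix.of fun i j => d i j x) ≤ 1 := by
      intro T hT
      have hm : Measurable fun x => frob (matOf T) (Matrix.of fun i j => d i j x) :=
        measurable_frob_of (D := fun x => Matrix.of fun i j => d i j x) hdm
          (G := fun _ => T) continuous_const
      have hi : Integrable (fun x => frob (matOf T) (Matrix.of fun i j => d i j x)) ν := by
        simp only [frob_sum, Matrix.of_apply]
        exact integrable_finsetSum _ fun i _ => integrable_finsetSum _ fun j _ =>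
          (hdi i j).const_mul _
      have := ae_nonneg_of_cc ν (fun x => 1 - frob (matOf T) (Matrix.of fun i j => d i j x))
        (measurable_const.sub hm) ((integrable_const _).sub hi) (fun φ hφ => by
          simp only [mul_sub, mul_one]
          rw [integral_sub (cc_integrable ν φ) (cc_mul_integrable φ hi), hν]
          have e : ∫ x, φ x * frob (matOf T) (Matrix.of fun i j => d i j x) ∂ν
              = L (ccSmul T φ) := by
            rw [← hL]
            simp only [ccSmul_apply, matOf_smul, frob_smul_left]
          rw [e, sub_nonneg]
          refine hb _ _ fun x => ?_
          rw [ccSmul_apply, norm_smul, Real.norm_of_nonneg (hφ x)]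
          exact mul_le_of_le_one_right (hφ x) hT)
      filter_upwards [this] with x hx
      linarith
    have : ProperSpace (Euc n →L[ℝ] Euc m) := FiniteDimensional.proper ℝ _
    have : SecondCountableTopology (Euc n →L[ℝ] Euc m) := inferInstance
    have : Nonempty {T : Euc n →L[ℝ] Euc m // ‖T‖ ≤ 1} := ⟨⟨0, by simp⟩⟩
    have hall : ∀ᵐ x ∂ν, ∀ k : ℕ,
        frob (matOf (TopologicalSpace.denseSeq {T : Euc n →L[ℝ] Euc m // ‖T‖ ≤ 1} k).1)
          (Matrix.of fun i j => d i j x) ≤ 1 := by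
      rw [ae_all_iff]
      intro k
      exact hT _ (TopologicalSpace.denseSeq {T : Euc n →L[ℝ] Euc m // ‖T‖ ≤ 1} k).2
    filter_upwards [hall] with x hx T hT1
    refine (TopologicalSpace.denseRange_denseSeq {T : Euc n →L[ℝ] Euc m // ‖T‖ ≤ 1}).induction_on
      (p := fun T => frob (matOf T.1) (Matrix.of fun i j => d i j x) ≤ 1) ⟨T, hT1⟩ ?_ hx
    refine isClosed_le ?_ continuous_const
    simp only [frob_sum, matOf, Matrix.of_apply]
    fun_prop

end Riesz

section Forward

open scoped CompactlySupported

variable {n m : ℕ}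

/-- Hahn-Banach for a subadditive gauge given by a supremum. -/
lemma hahn_banach_sup {E X : Type*} [AddCommMonoid E] [Module ℝ E] [Nonempty X]
    (D : Submodule ℝ E) (p : D →ₗ[ℝ] ℝ)
    (q : E → X → ℝ) {J : ℝ} (hJ : 0 ≤ J) (hbd : ∀ e, BddAbove (Set.range fun x => max (q e x) 0))
    (hom : ∀ c : ℝ, 0 < c → ∀ e x, q (c • e) x = c * q e x)
    (hadd : ∀ e e' x, q (e + e') x ≤ q e x + q e' x)
    (hp : ∀ (e : D) (c : ℝ), 0 ≤ c → (∀ x, q e x ≤ c) → p e ≤ J * c) :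
    ∃ g : E →ₗ[ℝ] ℝ, (∀ e : D, g e = p e) ∧
      ∀ (e : E) (c : ℝ), 0 ≤ c → (∀ x, q e x ≤ c) → g e ≤ J * c := by
  letI : AddCommGroup E := Module.addCommMonoidToAddCommGroup ℝ
  have N_hom : ∀ c : ℝ, 0 < c → ∀ e, J * (⨆ x, max (q (c • e) x) 0)
      = c * (J * ⨆ x, max (q e x) 0) := by
    intro c hc e
    have : ∀ x, max (q (c • e) x) 0 = c * max (q e x) 0 := fun x => by
      rw [hom c hc, mul_max_of_nonneg _ _ hc.le, mul_zero]
    simp only [this]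
    rw [← Real.mul_iSup_of_nonneg hc.le]
    ring
  have N_add : ∀ e e', J * (⨆ x, max (q (e + e') x) 0)
      ≤ J * (⨆ x, max (q e x) 0) + J * (⨆ x, max (q e' x) 0) := by
    intro e e'
    rw [← mul_add]
    refine mul_le_mul_of_nonneg_left (ciSup_le fun x => ?_) hJ
    have a1 : max (q e x) 0 ≤ ⨆ x, max (q e x) 0 := le_ciSup (hbd e) x
    have a2 : max (q e' x) 0 ≤ ⨆ x, max (q e' x) 0 := le_ciSup (hbd e') x
    have b1 := le_max_left (q e x) 0
    have b2 := le_max_left (q e' x) 0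
    have b3 := le_max_right (q e x) 0
    have b4 := le_max_right (q e' x) 0
    have := hadd e e' x
    refine max_le ?_ ?_ <;> linarith
  have hf : ∀ e : D, p e ≤ J * ⨆ x, max (q e x) 0 := by
    intro e
    obtain ⟨x0⟩ := ‹Nonempty X›
    refine hp e _ ?_ fun x => ?_
    · exact (le_max_right _ _).trans (le_ciSup (hbd e) x0)
    · exact (le_max_left _ _).trans (le_ciSup (hbd e) x)
  obtain ⟨g, h1, h2⟩ := exists_extension_of_le_sublinear (⟨D, p⟩ : E →ₗ.[ℝ] ℝ)
    (fun e => J * ⨆ x, max (q e x) 0) N_hom N_add hf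
  refine ⟨g, h1, fun e c hc h => (h2 e).trans ?_⟩
  exact mul_le_mul_of_nonneg_left (ciSup_le fun x => max_le (h x) hc) hJ

/-- Compactly supported `C¹` maps. -/
def ccOne (n m : ℕ) : Submodule ℝ (Euc n → Euc m) where
  carrier := {u | ContDiff ℝ 1 u ∧ HasCompactSupport u}
  add_mem' h h' := ⟨h.1.add h'.1, h.2.add h'.2⟩
  zero_mem' := ⟨contDiff_const, HasCompactSupport.zero⟩
  smul_mem' c u h := ⟨h.1.const_smul c, h.2.smul_left (f := fun _ => c)⟩

lemma pair_bound (μ : VecMeas n m) (h0 : μ.totalZero) (hμ : μ.finiteFirstMoment)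
    {u : Euc n → Euc m} (hu : ContDiff ℝ 1 u) {K : ℝ} (hK : ∀ x, ‖fderiv ℝ u x‖ ≤ K) :
    μ.pair u ≤ ∫ x, K * ‖x‖ ∂μ.var := by
  have hfin := μ.finite
  have hdi : Integrable μ.density μ.var := by
    refine Integrable.mono' (integrable_const 1) μ.measurable_density.aestronglyMeasurable ?_
    filter_upwards [μ.norm_density] with x hx using hx.le
  have hz : ∫ x, ⟪u 0, μ.density x⟫ ∂μ.var = 0 := by
    rw [integral_inner hdi]
    have : ∫ x, μ.density x ∂μ.var = 0 := h0
    rw [this, inner_zero_right]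
  have e : μ.pair u = ∫ x, ⟪u x - u 0, μ.density x⟫ ∂μ.var := by
    simp only [inner_sub_left]
    rw [integral_sub (μ.integrable_inner hμ hu hK) (hdi.const_inner _), hz, sub_zero]
    rfl
  rw [e]
  refine integral_mono_ae ?_ (Integrable.const_mul hμ K) ?_
  · simp only [inner_sub_left]
    exact (μ.integrable_inner hμ hu hK).sub (hdi.const_inner _)
  · filter_upwards [μ.inner_le (fun x => u x - u 0)] with x hx
    exact (le_abs_self _).trans (hx.trans (growth hu hK x))

lemma pair_smul (μ : VecMeas n m) (c : ℝ) (u : Euc n → Euc m) :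
    μ.pair (c • u) = c * μ.pair u := by
  unfold VecMeas.pair
  rw [← integral_const_mul]
  simp [inner_smul_left]

lemma Jsup_bdd (μ : VecMeas n m) (h0 : μ.totalZero) (hμ : μ.finiteFirstMoment) :
    BddAbove {r | ∃ f : Euc n → Euc m, C1b f ∧ C1Norm f ≤ 1 ∧ r = μ.pair f} := by
  refine ⟨∫ x, 1 * ‖x‖ ∂μ.var, ?_⟩
  rintro _ ⟨f, hf, hf1, rfl⟩
  exact pair_bound μ h0 hμ hf.1 fun x => (hf.norm_le x).trans hf1

lemma Jsup_nonneg (μ : VecMeas n m) (h0 : μ.totalZero) (hμ : μ.finiteFirstMoment) :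
    0 ≤ Jsup μ := by
  refine le_csSup (Jsup_bdd μ h0 hμ) ⟨fun _ => 0, ⟨contDiff_const, 0, ?_⟩, ?_, ?_⟩
  · intro x; simp
  · simp [C1Norm]
  · simp [VecMeas.pair]

lemma pair_le_Jsup (μ : VecMeas n m) (h0 : μ.totalZero) (hμ : μ.finiteFirstMoment)
    {u : Euc n → Euc m} (hu : ContDiff ℝ 1 u) {c : ℝ} (hc : 0 ≤ c)
    (hK : ∀ x, ‖fderiv ℝ u x‖ ≤ c) : μ.pair u ≤ Jsup μ * c := by
  have key : ∀ d : ℝ, c < d → μ.pair u ≤ Jsup μ * d := by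
    intro d hd
    have hd0 : 0 < d := hc.trans_lt hd
    have hb : ∀ x, ‖fderiv ℝ (d⁻¹ • u) x‖ ≤ 1 := by
      intro x
      rw [fderiv_const_smul (hu.differentiable one_ne_zero x), norm_smul,
        Real.norm_of_nonneg (inv_nonneg.2 hd0.le), inv_mul_le_iff₀ hd0, mul_one]
      exact (hK x).trans hd.le
    have : μ.pair (d⁻¹ • u) ≤ Jsup μ :=
      le_csSup (Jsup_bdd μ h0 hμ) ⟨d⁻¹ • u, ⟨hu.const_smul d⁻¹, 1, hb⟩, ciSup_le hb, rfl⟩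
    rw [pair_smul, inv_mul_le_iff₀ hd0] at this
    linarith
  have t : Tendsto (fun d => Jsup μ * d) (𝓝[>] c) (𝓝 (Jsup μ * c)) :=
    ((continuous_const.mul continuous_id).tendsto c).mono_left nhdsWithin_le_nhds
  refine ge_of_tendsto t ?_
  filter_upwards [self_mem_nhdsWithin] with d hd using key d hd

lemma ccOne_bdd (u : ccOne n m) : ∃ C : ℝ, ∀ x, ‖fderiv ℝ (u : Euc n → Euc m) x‖ ≤ C :=
  (u.2.1.continuous_fderiv one_ne_zero).bounded_above_of_compact_support (u.2.2.fderiv (𝕜 := ℝ))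

/-- The linear functional `u ↦ ∫ ⟨u, dμ⟩`. -/
def pairLin (μ : VecMeas n m) (hμ : μ.finiteFirstMoment) : ccOne n m →ₗ[ℝ] ℝ where
  toFun u := μ.pair u
  map_add' u v := by
    obtain ⟨C, hC⟩ := ccOne_bdd u
    obtain ⟨C', hC'⟩ := ccOne_bdd v
    unfold VecMeas.pair
    rw [← integral_add (μ.integrable_inner hμ u.2.1 hC) (μ.integrable_inner hμ v.2.1 hC')]
    simp [inner_add_left]
  map_smul' c u := pair_smul μ c u

section triple

variable {A B C : Type*} [AddCommMonoid A] [AddCommMonoid B] [AddCommMonoid C] [Module ℝ A]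
  [Module ℝ B] [Module ℝ C]

lemma triple_one (b : B) (c : C) :
    ((0, b, (-1 : ℝ) • c) : A × B × C) = (0, b, 0) + (-1 : ℝ) • (0, 0, c) := by
  simp

lemma triple_two (a : A) (b : B) :
    (((-1 : ℝ) • a, b, 0) : A × B × C) = (-1 : ℝ) • (a, 0, 0) + (0, b, 0) := by
  simp

lemma triple_three (a : A) (b : B) :
    ((a, (-1 : ℝ) • b, 0) : A × B × C) = (a, 0, 0) + (-1 : ℝ) • (0, b, 0) := by
  simp

end triple

lemma exists_functionals (μ : VecMeas n m) (h0 : μ.totalZero) (hμ : μ.finiteFirstMoment) :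
    ∃ (L : C_c(Euc n, Euc n →L[ℝ] Euc m) →ₗ[ℝ] ℝ) (Λ : C_c(Euc n, ℝ) →ₗ[ℝ] ℝ),
      (∀ (G : C_c(Euc n, Euc n →L[ℝ] Euc m)) (φ : C_c(Euc n, ℝ)),
        (∀ x, ‖G x‖ ≤ φ x) → L G ≤ Λ φ) ∧
      (∀ φ : C_c(Euc n, ℝ), (∀ x, φ x ≤ 1) → Λ φ ≤ Jsup μ) ∧
      (∀ (u : Euc n → Euc m) (G : C_c(Euc n, Euc n →L[ℝ] Euc m)), ContDiff ℝ 1 u →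
        HasCompactSupport u → (∀ x, G x = fderiv ℝ u x) → L G = μ.pair u) := by
  let E := ccOne n m × C_c(Euc n, Euc n →L[ℝ] Euc m) × C_c(Euc n, ℝ)
  let D : Submodule ℝ E := Submodule.prod ⊤ ⊥
  let p : D →ₗ[ℝ] ℝ := (pairLin μ hμ ∘ₗ LinearMap.fst ℝ _ _) ∘ₗ D.subtype
  let q : E → Euc n → ℝ := fun e x => ‖fderiv ℝ (e.1 : Euc n → Euc m) x + e.2.1 x‖ + e.2.2 x
  have H := hahn_banach_sup D p q (Jsup_nonneg μ h0 hμ) ?_ ?_ ?_ ?_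
  · obtain ⟨g, hg1, hg2⟩ := H
    refine ⟨g ∘ₗ LinearMap.inr ℝ _ _ ∘ₗ LinearMap.inl ℝ _ _,
      g ∘ₗ LinearMap.inr ℝ _ _ ∘ₗ LinearMap.inr ℝ _ _, ?_, ?_, ?_⟩
    · intro G φ h
      have := hg2 (0, G, (-1 : ℝ) • φ) 0 le_rfl (fun x => by
        have := h x
        simp [q]
        exact this)
      have e : ((0, G, (-1 : ℝ) • φ) : E) = (0, G, 0) + (-1 : ℝ) • (0, 0, φ) :=
        triple_one (A := ccOne n m) (B := C_c(Euc n, Euc n →L[ℝ] Euc m)) (C := C_c(Euc n, ℝ)) G φ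
      rw [e, map_add, map_smul] at this
      show g (0, G, 0) ≤ g (0, 0, φ)
      simp only [mul_zero, smul_eq_mul] at this
      linarith
    · intro φ h
      have := hg2 (0, 0, φ) 1 zero_le_one (fun x => by
        have := h x
        simp [q]
        exact this)
      rwa [mul_one] at this
    · intro u G hu hus hG
      let U : ccOne n m := ⟨u, hu, hus⟩
      have hU : g (U, 0, 0) = μ.pair u := hg1 ⟨(U, 0, 0), ⟨trivial, rfl⟩⟩
      have hneg : ∀ x, fderiv ℝ ((-1 : ℝ) • u) x = -fderiv ℝ u x := fun x => by
        rw [fderiv_const_smul (hu.differentiable one_ne_zero x)]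
        exact neg_one_smul ℝ (fderiv ℝ u x)
      have a1 := hg2 ((-1 : ℝ) • U, G, 0) 0 le_rfl (fun x => by
        show ‖fderiv ℝ ((-1 : ℝ) • u) x + G x‖ + 0 ≤ 0
        rw [hneg, hG, neg_add_cancel, norm_zero, add_zero])
      have a2 := hg2 (U, (-1 : ℝ) • G, 0) 0 le_rfl (fun x => by
        show ‖fderiv ℝ u x + (-1 : ℝ) • G x‖ + 0 ≤ 0
        have : (-1 : ℝ) • G x = -fderiv ℝ u x := by
          rw [hG]; exact neg_one_smul ℝ (fderiv ℝ u x)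
        rw [this, add_neg_cancel, norm_zero, add_zero])
      have e1 : (((-1 : ℝ) • U, G, 0) : E) = (-1 : ℝ) • (U, 0, 0) + (0, G, 0) :=
        triple_two (A := ccOne n m) (B := C_c(Euc n, Euc n →L[ℝ] Euc m)) (C := C_c(Euc n, ℝ)) U G
      have e2 : ((U, (-1 : ℝ) • G, 0) : E) = (U, 0, 0) + (-1 : ℝ) • (0, G, 0) :=
        triple_three (A := ccOne n m) (B := C_c(Euc n, Euc n →L[ℝ] Euc m)) (C := C_c(Euc n, ℝ)) U G
      rw [e1, map_add, map_smul, hU] at a1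
      rw [e2, map_add, map_smul, hU] at a2
      show g (0, G, 0) = μ.pair u
      simp only [mul_zero, smul_eq_mul] at a1 a2
      linarith
  · intro e
    obtain ⟨A, hA⟩ := ccOne_bdd e.1
    obtain ⟨B, hB⟩ := cc_bdd e.2.1
    obtain ⟨C, hC⟩ := cc_bdd e.2.2
    refine ⟨max (A + B + C) 0, ?_⟩
    rintro _ ⟨x, rfl⟩
    refine max_le_max ?_ le_rfl
    have h1 := norm_add_le (fderiv ℝ (e.1 : Euc n → Euc m) x) (e.2.1 x)
    have h2 := hA x
    have h3 := hB x
    have h4 := (le_abs_self _).trans (hC x)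
    simp only [q]
    linarith
  · intro c hc e x
    have h1 : fderiv ℝ (c • (e.1 : Euc n → Euc m)) x = c • fderiv ℝ (e.1 : Euc n → Euc m) x :=
      fderiv_const_smul (e.1.2.1.differentiable one_ne_zero x) c
    show ‖fderiv ℝ (c • (e.1 : Euc n → Euc m)) x + c • e.2.1 x‖ + c * e.2.2 x = _
    have h2 : c • fderiv ℝ (e.1 : Euc n → Euc m) x + c • e.2.1 x
        = c • (fderiv ℝ (e.1 : Euc n → Euc m) x + e.2.1 x) := (smul_add c _ _).symm
    rw [h1, h2, norm_smul, Real.norm_of_nonneg hc.le, mul_add]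
  · intro e e' x
    have h1 : fderiv ℝ ((e.1 : Euc n → Euc m) + (e'.1 : Euc n → Euc m)) x
        = fderiv ℝ (e.1 : Euc n → Euc m) x + fderiv ℝ (e'.1 : Euc n → Euc m) x :=
      fderiv_add (e.1.2.1.differentiable one_ne_zero x) (e'.1.2.1.differentiable one_ne_zero x)
    show ‖fderiv ℝ ((e.1 : Euc n → Euc m) + (e'.1 : Euc n → Euc m)) x + (e.2.1 x + e'.2.1 x)‖
      + (e.2.2 x + e'.2.2 x) ≤ _
    rw [h1, add_add_add_comm]
    have := norm_add_le (fderiv ℝ (e.1 : Euc n → Euc m) x + e.2.1 x)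
      (fderiv ℝ (e'.1 : Euc n → Euc m) x + e'.2.1 x)
    simp only [q]
    linarith
  · rintro ⟨⟨u, G, φ⟩, he⟩ c hc h
    have he' : G = 0 ∧ φ = 0 := by
      have h2 : (G, φ) = (0, 0) := he.2
      exact Prod.mk.inj h2
    obtain ⟨rfl, rfl⟩ := he'
    refine pair_le_Jsup μ h0 hμ u.2.1 hc fun x => ?_
    simpa [q] using h x

theorem forward_part (f : Euc n → Euc m) (hf : C1b f) (hf1 : C1Norm f = 1)
    (μ : VecMeas n m) (h0 : μ.totalZero) (hμ : μ.finiteFirstMoment) (hJ : Jsup μ = μ.pair f) :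
    ∃ M : MatMeas n m, IsNegDiv M μ ∧
        (∀ᵐ x ∂M.var,
          fderivMat f x * (fderivMat f x)ᴴ * M.density x = M.density x ∧
          ((fderivMat f x)ᴴ * M.density x).PosSemidef) ∧
        M.tvNorm = μ.pair f := by
  obtain ⟨L, Λ, hb, hc, hL⟩ := exists_functionals μ h0 hμ
  obtain ⟨ν, D, hfin, hmass, hDm, hrepr, hD1⟩ :=
    exists_matrix_density L Λ (Jsup_nonneg μ h0 hμ) hb hc
  have htr : ∀ᵐ x ∂ν, Matrix.trace (matAbs (D x)) ≤ 1 := by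
    filter_upwards [hD1] with x hx
    obtain ⟨A, hA, e⟩ := exists_frob_eq (D x)
    rw [← e]
    simpa [matOf_opOf] using hx (opOf A) hA
  have hDb : ∀ᵐ x ∂ν, ∀ T : Euc n →L[ℝ] Euc m, ‖frob (matOf T) (D x)‖ ≤ ‖T‖ := by
    filter_upwards [htr] with x hx T
    have := _root_.frob_le (matOf T) (D x)
    rw [opOf_matOf] at this
    exact this.trans (mul_le_of_le_one_right (norm_nonneg _) hx)
  have hrep : ∀ u : Euc n → Euc m, C1b u → μ.pair u = ∫ x, frob (fderivMat u x) (D x) ∂ν := by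
    intro u hu
    refine pair_extend_gen ν D hDm hDb μ hμ ?_ hu
    intro v hv hvs
    let G : C_c(Euc n, Euc n →L[ℝ] Euc m) :=
      ⟨⟨fderiv ℝ v, hv.continuous_fderiv one_ne_zero⟩, hvs.fderiv (𝕜 := ℝ)⟩
    rw [← hL v G hv hvs fun x => rfl, ← hrepr]
    rfl
  have hfn : ∀ x, ‖fderiv ℝ f x‖ ≤ 1 := fun x => hf1 ▸ hf.norm_le x
  have hle : ∀ᵐ x ∂ν, frob (fderivMat f x) (D x) ≤ 1 := by
    filter_upwards [hD1] with x hx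
    exact hx _ (hfn x)
  have hfi : Integrable (fun x => frob (fderivMat f x) (D x)) ν := by
    refine Integrable.mono' (integrable_const 1) (measurable_frob_of hDm
      (hf.1.continuous_fderiv one_ne_zero)).aestronglyMeasurable ?_
    filter_upwards [hDb] with x hx
    exact (hx _).trans (hfn x)
  have hI : ∫ x, (1 - frob (fderivMat f x) (D x)) ∂ν = (ν Set.univ).toReal - Jsup μ := by
    rw [integral_sub (integrable_const _) hfi, ← hrep f hf, hJ]
    simp [Measure.real]
  have hnn : 0 ≤ᵐ[ν] fun x => 1 - frob (fderivMat f x) (D x) := by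
    filter_upwards [hle] with x hx
    simpa using hx
  have hz : ∫ x, (1 - frob (fderivMat f x) (D x)) ∂ν = 0 := by
    refine le_antisymm ?_ (integral_nonneg_of_ae hnn)
    rw [hI]; linarith
  have heq : ∀ᵐ x ∂ν, frob (fderivMat f x) (D x) = 1 := by
    have := (integral_eq_zero_iff_of_nonneg_ae hnn ((integrable_const _).sub hfi)).1 hz
    filter_upwards [this] with x hx
    simp at hx
    linarith
  have hop : ∀ x, ‖opOf (fderivMat f x)‖ ≤ 1 := fun x => by
    rw [fderivMat_eq, opOf_matOf]; exact hfn x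
  have htr1 : ∀ᵐ x ∂ν, Matrix.trace (matAbs (D x)) = 1 := by
    filter_upwards [heq, htr, hD1] with x h1 h2 h3
    refine le_antisymm h2 ?_
    have h4 := _root_.frob_le (fderivMat f x) (D x)
    rw [h1, abs_one] at h4
    by_contra hlt
    push Not at hlt
    rcases le_total 0 (Matrix.trace (matAbs (D x))) with hs | hs
    · have := mul_le_of_le_one_left hs (hop x)
      linarith
    · have := mul_nonpos_of_nonneg_of_nonpos (norm_nonneg (opOf (fderivMat f x))) hs
      linarith
  refine ⟨⟨ν, D, hfin, hDm, htr1⟩, fun u hu => hrep u hu.toC1b, ?_, ?_⟩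
  · show ∀ᵐ x ∂ν, _
    filter_upwards [heq, htr1] with x h1 h2
    exact frob_eq_case _ _ (hop x) (h1.trans h2.symm)
  · show (ν Set.univ).toReal = _
    rw [← hJ]
    linarith

end Forward

/-- **Theorem 6.3 (representation of polar cones to tangent cones of the unit
ball of C¹(ℝⁿ, ℝᵐ))**: let f ∈ C¹(ℝⁿ, ℝᵐ) with ‖f‖_{C¹} = 1.  For every
μ ∈ 𝒫_f (i.e. μ(ℝⁿ) = 0, finite first moments and J(μ) = ∫⟨f, dμ⟩) there is
M ∈ 𝓜(ℝⁿ, ℝ^{m×n}) with −div M = μ, ‖M‖_𝓜 = ∫⟨f, dμ⟩, and ‖M‖₁-a.e.: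
(i) Df Df^* = Id on the image of dM/d‖M‖₁ (equivalently
Df Df^* ⬝ (dM/d‖M‖₁) = dM/d‖M‖₁), and (ii) Df^* (dM/d‖M‖₁) is symmetric
positive semidefinite.  Conversely, if M satisfies (i) and (ii) ‖M‖₁-a.e. and
−div M is a finite vector-valued measure μ, then μ ∈ 𝒫_f. -/
theorem polarCone_C1_representation {n m : ℕ} (f : Euc n → Euc m)
    (hf : C1b f) (hf1 : C1Norm f = 1) :
    (∀ μ : VecMeas n m, μ.totalZero → μ.finiteFirstMoment →
      Jsup μ = μ.pair f →
      ∃ M : MatMeas n m, IsNegDiv M μ ∧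
        (∀ᵐ x ∂M.var,
          fderivMat f x * (fderivMat f x)ᴴ * M.density x = M.density x ∧
          ((fderivMat f x)ᴴ * M.density x).PosSemidef) ∧
        M.tvNorm = μ.pair f) ∧
    (∀ M : MatMeas n m,
      (∀ᵐ x ∂M.var,
        fderivMat f x * (fderivMat f x)ᴴ * M.density x = M.density x ∧
        ((fderivMat f x)ᴴ * M.density x).PosSemidef) →
      ∀ μ : VecMeas n m, IsNegDiv M μ →
      μ.totalZero ∧ μ.finiteFirstMoment ∧ Jsup μ = μ.pair f) := by
  exact ⟨fun μ h0 hμ hJ => forward_part f hf hf1 μ h0 hμ hJ,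
    fun M hM μ h => converse_part f hf hf1 M hM μ h⟩
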